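/- arXiv:2401.08883 — 4 statements merged into one kernel-verified Lean document; each statement's English description precedes it below -/
import Mathlib

section
/- Let X be a Hausdorff topological space and α, β : [0,1] → X be paths. If α ∘ g₁ ≃ᵣ β ∘ g₂ for some nondecreasing continuous surjections g₁, g₂ : [0,1] → [0,1], then α ≃ᵣ β. -/
open Set Filter Topology

noncomputable section

/-- An ℝ-tree: a nonempty geodesic, uniquely arcwise connected, locally arcwise connected
metric space. -/
structure IsRTree (T : Type) [MetricSpace T] : Prop where
  nonempty : Nonempty T
  geodesic : ∀ x y : T, ∃ γ : ℝ → T, γ 0 = x ∧ γ (dist x y) = y ∧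
    ∀ s ∈ Set.Icc (0:ℝ) (dist x y), ∀ t ∈ Set.Icc (0:ℝ) (dist x y),
      dist (γ s) (γ t) = |s - t|
  uniquelyArcwise : ∀ p q : unitInterval → T, Continuous p → Continuous q →
    Function.Injective p → Function.Injective q → p 0 = q 0 → p 1 = q 1 →
    Set.range p = Set.range q
  locallyArcwise : LocPathConnectedSpace T

/-- `β` is a geodesic ℝ-tree reduction of `α`, i.e. `α ≥ᵣ β`. -/
def GeodesicReduction {X : Type*} [TopologicalSpace X] (α β : unitInterval → X) : Prop :=
  ∃ (T : Type) (_ : MetricSpace T), IsRTree T ∧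
    ∃ (f : T → X) (p r : unitInterval → T),
      Continuous f ∧ Continuous p ∧ Continuous r ∧ Function.Injective r ∧
      r 0 = p 0 ∧ r 1 = p 1 ∧ f ∘ p = α ∧ f ∘ r = β

/-- The concatenation of `α` with the reverse of `β`: `α` on `[0,1/2]`, reverse of `β`
on `[1/2,1]`. -/
def ConcatReverse {X : Type*} (α β : unitInterval → X) : unitInterval → X :=
  fun t => if (t : ℝ) ≤ 1 / 2
    then α (Set.projIcc (0:ℝ) 1 zero_le_one (2 * (t : ℝ)))
    else β (Set.projIcc (0:ℝ) 1 zero_le_one (2 - 2 * (t : ℝ)))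

/-- The standard concatenation `α·β`: `α` on `[0,1/2]`, `β` on `[1/2,1]`. -/
def PathConcat {X : Type*} (α β : unitInterval → X) : unitInterval → X :=
  fun t => if (t : ℝ) ≤ 1 / 2
    then α (Set.projIcc (0:ℝ) 1 zero_le_one (2 * (t : ℝ)))
    else β (Set.projIcc (0:ℝ) 1 zero_le_one (2 * (t : ℝ) - 1))

/-- `α ≃ᵣ β`: the loop `α·(reverse β)` factors through an ℝ-tree. -/
def RTreeHomotopic {X : Type*} [TopologicalSpace X] (α β : unitInterval → X) : Prop :=
  α 0 = β 0 ∧ α 1 = β 1 ∧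
  ∃ (T : Type) (_ : MetricSpace T), IsRTree T ∧
    ∃ (f : T → X) (ℓ : unitInterval → T),
      Continuous f ∧ Continuous ℓ ∧ ℓ 0 = ℓ 1 ∧ f ∘ ℓ = ConcatReverse α β

/-- `α ≡ β`: equality up to an increasing self-homeomorphism of `[0,1]`. -/
def PathEquiv {X : Type*} (α β : unitInterval → X) : Prop :=
  ∃ h : unitInterval ≃ₜ unitInterval, StrictMono (⇑h) ∧ α = β ∘ ⇑h

/-- Fréchet equivalence of paths. -/
def FrechetEquiv {X : Type*} (α β : unitInterval → X) : Prop :=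
  ∃ f g : unitInterval → unitInterval,
    Continuous f ∧ Continuous g ∧ Monotone f ∧ Monotone g ∧
    Function.Surjective f ∧ Function.Surjective g ∧ α ∘ f = β ∘ g

/-- `p` lifts all paths uniquely rel. starting point. -/
def LiftsPathsUniquely {E X : Type*} [TopologicalSpace E] [TopologicalSpace X]
    (p : E → X) : Prop :=
  ∀ α : unitInterval → X, Continuous α → ∀ e : E, p e = α 0 →
    ∃! αl : unitInterval → E, Continuous αl ∧ αl 0 = e ∧ p ∘ αl = α

/-- An open `U ⊆ (0,1)` is a Cantor complement if `[0,1] \ U` is homeomorphic to the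
Cantor set. -/
def IsCantorComplement (U : Set ℝ) : Prop :=
  IsOpen U ∧ U ⊆ Set.Ioo 0 1 ∧ Nonempty (↥(Set.Icc (0:ℝ) 1 \ U) ≃ₜ (ℕ → Bool))

/-- `𝒪(α)`: the set of points of `[0,1]` (as reals) at which `α` is locally constant. -/
def Oset {X : Type*} [TopologicalSpace X] (α : unitInterval → X) : Set ℝ :=
  {x | ∃ hx : x ∈ unitInterval,
    ∃ U ∈ nhds (⟨x, hx⟩ : unitInterval), ∀ s ∈ U, α s = α ⟨x, hx⟩}

/-- A Cantor path: a non-constant path whose locally-constant set is a Cantor complement. -/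
def IsCantorPath {X : Type*} [TopologicalSpace X] (α : unitInterval → X) : Prop :=
  Continuous α ∧ (∃ s t, α s ≠ α t) ∧ IsCantorComplement (Oset α)

/-- Two Cantor paths are staggered if their locally-constant sets cover `(0,1)`. -/
def StaggeredPaths {X : Type*} [TopologicalSpace X] (α β : unitInterval → X) : Prop :=
  Oset α ∪ Oset β = Set.Ioo 0 1

/-- The restriction of `β` to `[a,b]`, linearly reparameterized on `[0,1]`. -/
def restrictIcc {X : Type*} (β : unitInterval → X) (a b : ℝ) : unitInterval → X :=
  fun t => β (Set.projIcc (0:ℝ) 1 zero_le_one (a + (b - a) * (t : ℝ)))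

/-- A Cantor-inverse-pair loop (CIP-loop). -/
def IsCIPLoop {X : Type*} [TopologicalSpace X] (ℓ : unitInterval → X) : Prop :=
  ∃ (α : unitInterval → X) (h : unitInterval ≃ₜ unitInterval), StrictMono (⇑h) ∧
    ℓ ∘ ⇑h = ConcatReverse α α ∧
    (IsCantorPath α ∨
      ∃ (α₁ : unitInterval → X) (x : X) (h' : unitInterval ≃ₜ unitInterval),
        StrictMono (⇑h') ∧ IsCantorPath α₁ ∧ α ∘ ⇑h' = PathConcat α₁ (fun _ => x))

/-- `β` is a `𝒰`-extension of `α` for `𝒰` a set of connected components of `𝒪(α)`. -/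
def UExtension {X : Type*} [TopologicalSpace X] (α β : unitInterval → X)
    (𝒰 : Set (Set ℝ)) : Prop :=
  (∀ J ∈ 𝒰, ∃ x ∈ Oset α, J = connectedComponentIn (Oset α) x) ∧
  (∀ t : unitInterval, (t : ℝ) ∉ ⋃₀ 𝒰 → β t = α t) ∧
  (∀ J ∈ 𝒰, IsCIPLoop (restrictIcc β (sInf J) (sSup J)))

/-- `α ⪯* β`: `β` is a `𝒰`-extension of `α` for some `𝒰 ⊆ lc(α)`. -/
def PrecExt {X : Type*} [TopologicalSpace X] (α β : unitInterval → X) : Prop :=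
  ∃ 𝒰 : Set (Set ℝ), UExtension α β 𝒰

/-- The sup-metric `ρ` on paths into a metric space. -/
def pathDist {X : Type*} [PseudoMetricSpace X] (α β : unitInterval → X) : ℝ :=
  ⨆ t : unitInterval, dist (α t) (β t)

/-- The image of a set `U ⊆ [0,1] ⊆ ℝ` under a self-homeomorphism of `[0,1]`. -/
def imageOnIcc (f : unitInterval ≃ₜ unitInterval) (U : Set ℝ) : Set ℝ :=
  Subtype.val '' (⇑f '' (Subtype.val ⁻¹' U))

/-- The Euclidean half-space of dimension `n` (all of `ℝ⁰` when `n = 0`). -/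
def halfSpace (n : ℕ) : Set (EuclideanSpace ℝ (Fin n)) :=
  {y | ∀ i : Fin n, (i : ℕ) = 0 → 0 ≤ y i}

/-- A topological manifold with (possibly empty) boundary: second countable, Hausdorff,
locally homeomorphic to open subsets of Euclidean half-spaces. -/
def IsTopManifold (M : Type*) [TopologicalSpace M] : Prop :=
  SecondCountableTopology M ∧ T2Space M ∧
  ∀ x : M, ∃ (n : ℕ) (U : Set M) (V : Set (halfSpace n)),
    U ∈ nhds x ∧ IsOpen V ∧ Nonempty (↥U ≃ₜ ↥V)

/-- The closed unit disk in the Euclidean plane. -/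
abbrev Disk2 : Type := ↥(Metric.closedBall (0 : EuclideanSpace ℝ (Fin 2)) 1)

end

noncomputable section

/-- In a metric space where `a` and `b` being on the same side of `z` is a transitive relation,
every path from `x` to `y` passes through every point metrically between `x` and `y`. -/
theorem mem_range_of_dist_add_dist {T : Type*} [MetricSpace T]
    (htrans : ∀ z a b c : T, dist a b < dist a z + dist z b → dist b c < dist b z + dist z c →
      dist a c < dist a z + dist z c)
    {p : unitInterval → T} (hp : Continuous p) {z : T}
    (hz : dist (p 0) z + dist z (p 1) = dist (p 0) (p 1)) : z ∈ range p := by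
  by_contra hzp
  have hne : ∀ u, 0 < dist (p u) z := fun u =>
    dist_pos.2 fun h => hzp ⟨u, h⟩
  set A : Set unitInterval := {u | dist (p u) (p 0) < dist (p u) z + dist z (p 0)} with hA
  have hopen : IsOpen A := isOpen_lt (by fun_prop) (by fun_prop)
  have hclosed : IsClosed A := by
    rw [← isOpen_compl_iff, isOpen_iff_mem_nhds]
    intro u hu
    have : ∀ᶠ v in 𝓝 u, dist (p u) (p v) < dist (p u) z + dist z (p v) := by
      refine (isOpen_lt (by fun_prop) (by fun_prop)).mem_nhds ?_
      simp only [mem_ofPred_eq, dist_self, dist_comm z]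
      linarith [hne u]
    filter_upwards [this] with v hv hvA
    exact hu (htrans _ _ _ _ hv hvA)
  have hA0 : (0 : unitInterval) ∈ A := by
    simp only [hA, mem_ofPred_eq, dist_self, dist_comm z]
    linarith [hne 0]
  have huniv : A = univ := (isClopen_iff.1 ⟨hclosed, hopen⟩).resolve_left
    (nonempty_iff_ne_empty.1 ⟨0, hA0⟩)
  have h1 : (1 : unitInterval) ∈ A := huniv ▸ mem_univ _
  simp only [hA, mem_ofPred_eq] at h1
  rw [dist_comm (p 1) (p 0), dist_comm (p 1), dist_comm z (p 0)] at h1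
  linarith

/-- The image of an arc contains no proper connected subset joining the endpoints. -/
theorem range_subset_of_isPreconnected {T : Type*} [TopologicalSpace T] [T2Space T]
    {p : unitInterval → T} (hp : Continuous p) (hinj : Function.Injective p) {S : Set T}
    (hS : IsPreconnected S) (hSp : S ⊆ range p) (h0 : p 0 ∈ S) (h1 : p 1 ∈ S) :
    range p ⊆ S := by
  rintro _ ⟨u, rfl⟩
  obtain ⟨w, hwS, ⟨a, ha, rfl⟩, b, hb, hab⟩ := isPreconnected_closed_iff.1 hS (p '' Iic u)
    (p '' Ici u) (isClosed_Iic.isCompact.image hp).isClosed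
    (isClosed_Ici.isCompact.image hp).isClosed
    (fun w hw => by
      obtain ⟨v, rfl⟩ := hSp hw
      exact (le_total v u).imp (mem_image_of_mem p) (mem_image_of_mem p))
    ⟨_, h0, mem_image_of_mem p unitInterval.nonneg'⟩ ⟨_, h1, mem_image_of_mem p unitInterval.le_one'⟩
  obtain rfl : b = a := hinj hab
  obtain rfl : b = u := le_antisymm ha hb
  exact hwS

theorem isRTree_of_geodesic_of_trans {T : Type} [MetricSpace T] [Nonempty T]
    (hgeo : ∀ x y : T, ∃ γ : ℝ → T, γ 0 = x ∧ γ (dist x y) = y ∧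
      ∀ s ∈ Icc (0 : ℝ) (dist x y), ∀ t ∈ Icc (0 : ℝ) (dist x y), dist (γ s) (γ t) = |s - t|)
    (htrans : ∀ z a b c : T, dist a b < dist a z + dist z b → dist b c < dist b z + dist z c →
      dist a c < dist a z + dist z c) : IsRTree T := by
  have hcont : ∀ {γ : ℝ → T} {d : ℝ}, (∀ s ∈ Icc (0 : ℝ) d, ∀ t ∈ Icc (0 : ℝ) d,
      dist (γ s) (γ t) = |s - t|) → ContinuousOn γ (Icc 0 d) := fun {γ d} h =>
    (LipschitzOnWith.of_dist_le_mul (K := 1) fun s hs t ht => by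
      simp [h s hs t ht, Real.dist_eq]).continuousOn
  refine ⟨inferInstance, hgeo, ?_, ?_⟩
  · intro p q hp hq hpi hqi h0 h1
    obtain ⟨γ, hγ0, hγ1, hγ⟩ := hgeo (p 0) (p 1)
    have hd : (0 : ℝ) ≤ dist (p 0) (p 1) := dist_nonneg
    have hadd : ∀ z ∈ γ '' Icc 0 (dist (p 0) (p 1)),
        dist (p 0) z + dist z (p 1) = dist (p 0) (p 1) := by
      rintro _ ⟨s, hs, rfl⟩
      have e1 := hγ 0 ⟨le_rfl, hd⟩ s hs
      have e2 := hγ s hs _ ⟨hd, le_rfl⟩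
      rw [hγ0, zero_sub, abs_neg, abs_of_nonneg hs.1] at e1
      rw [hγ1, abs_sub_comm, abs_of_nonneg (sub_nonneg.2 hs.2)] at e2
      linarith
    have hpre : IsPreconnected (γ '' Icc 0 (dist (p 0) (p 1))) :=
      isPreconnected_Icc.image _ (hcont hγ)
    have key : ∀ r : unitInterval → T, Continuous r → Function.Injective r → r 0 = p 0 →
        r 1 = p 1 → range r = γ '' Icc 0 (dist (p 0) (p 1)) := by
      intro r hr hri hr0 hr1
      have hsub : γ '' Icc 0 (dist (p 0) (p 1)) ⊆ range r := fun z hz =>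
        mem_range_of_dist_add_dist htrans hr (by rw [hr0, hr1]; exact hadd z hz)
      refine (range_subset_of_isPreconnected hr hri hpre hsub ?_ ?_).antisymm hsub
      · exact ⟨0, ⟨le_rfl, hd⟩, by rw [hγ0, hr0]⟩
      · exact ⟨_, ⟨hd, le_rfl⟩, by rw [hγ1, hr1]⟩
    rw [key p hp hpi rfl rfl, key q hq hqi h0.symm h1.symm]
  · refine LocallyPathConnectedSpace.of_bases (p := fun _ r => 0 < r)
      (s := fun x r => Metric.ball x r) (fun x => Metric.nhds_basis_ball) fun x r hr => ?_
    refine ⟨x, Metric.mem_ball_self hr, fun {y} hy => ?_⟩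
    obtain ⟨γ, hγ0, hγ1, hγ⟩ := hgeo x y
    have hd : (0 : ℝ) ≤ dist x y := dist_nonneg
    refine JoinedIn.ofLine (f := fun t => γ (dist x y * t)) ?_ (by simpa using hγ0)
      (by simpa using hγ1) ?_
    · refine (hcont hγ).comp (by fun_prop) fun t ht => ⟨mul_nonneg hd ht.1, ?_⟩
      exact mul_le_of_le_one_right hd ht.2
    · rintro _ ⟨t, ht, rfl⟩
      have := hγ (dist x y * t) ⟨mul_nonneg hd ht.1, mul_le_of_le_one_right hd ht.2⟩ 0
        ⟨le_rfl, hd⟩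
      rw [hγ0, sub_zero, abs_of_nonneg (mul_nonneg hd ht.1)] at this
      rw [Metric.mem_ball, this]
      rw [Metric.mem_ball, dist_comm] at hy
      exact (mul_le_of_le_one_right hd ht.2).trans_lt hy

/-- Two geodesics issuing from `o` in an ℝ-tree agree up to height `c` if their endpoints are
closer to each other than the first endpoint is to height `c`. -/
theorem IsRTree.geodesic_eq {T : Type} [MetricSpace T] (hT : IsRTree T) {σ σ' : ℝ → T} {a a' c : ℝ}
    (hσ : ∀ s ∈ Icc (0 : ℝ) a, ∀ t ∈ Icc (0 : ℝ) a, dist (σ s) (σ t) = |s - t|)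
    (hσ' : ∀ s ∈ Icc (0 : ℝ) a', ∀ t ∈ Icc (0 : ℝ) a', dist (σ' s) (σ' t) = |s - t|)
    (h0 : σ 0 = σ' 0) (hc : 0 ≤ c) (hd : dist (σ a) (σ' a') < a - c)
    (ha' : 0 ≤ a') : σ c = σ' c := by
  have ha0 : 0 ≤ a := by linarith [dist_nonneg (x := σ a) (y := σ' a')]
  have hca : c < a := by linarith [dist_nonneg (x := σ a) (y := σ' a')]
  have hh : ∀ s ∈ Icc (0 : ℝ) a, dist (σ 0) (σ s) = s := fun s hs => by
    rw [hσ 0 ⟨le_rfl, ha0⟩ s hs, zero_sub, abs_neg, abs_of_nonneg hs.1]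
  have hh' : ∀ s ∈ Icc (0 : ℝ) a', dist (σ 0) (σ' s) = s := fun s hs => by
    rw [h0, hσ' 0 ⟨le_rfl, ha'⟩ s hs, zero_sub, abs_neg, abs_of_nonneg hs.1]
  have hca' : c < a' := by
    have := dist_triangle_right (σ 0) (σ a) (σ' a')
    rw [hh a ⟨ha0, le_rfl⟩, hh' a' ⟨ha', le_rfl⟩] at this
    linarith
  -- heights are determined by points
  have hheight : ∀ s ∈ Icc (0 : ℝ) a, ∀ t ∈ Icc (0 : ℝ) a', σ s = σ' t → s = t := by
    intro s hs t ht h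
    rw [← hh s hs, h, hh' t ht]
  have hcσ : ContinuousOn σ (Icc 0 a) := (LipschitzOnWith.of_dist_le_mul (K := 1)
    fun s hs t ht => by simp [hσ s hs t ht, Real.dist_eq]).continuousOn
  have hcσ' : ContinuousOn σ' (Icc 0 a') := (LipschitzOnWith.of_dist_le_mul (K := 1)
    fun s hs t ht => by simp [hσ' s hs t ht, Real.dist_eq]).continuousOn
  set A : Set ℝ := {s ∈ Icc 0 c | σ s = σ' s} with hA
  have hAc : IsCompact A := by
    have : A = Icc 0 c ∩ (fun s => dist (σ s) (σ' s)) ⁻¹' {0} := by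
      ext s; simp [hA, dist_eq_zero]
    rw [this]
    refine isCompact_Icc.of_isClosed_subset (ContinuousOn.preimage_isClosed_of_isClosed ?_
      isClosed_Icc isClosed_singleton) inter_subset_left
    exact continuous_dist.comp_continuousOn ((hcσ.mono (Icc_subset_Icc_right hca.le)).prodMk
      (hcσ'.mono (Icc_subset_Icc_right hca'.le)))
  obtain ⟨u, hu⟩ := hAc.exists_isGreatest ⟨0, ⟨le_rfl, hc⟩, h0⟩
  obtain ⟨⟨⟨hu0, huc⟩, hueq⟩, humax⟩ := hu
  rcases huc.eq_or_lt with rfl | huc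
  · exact hueq
  by_contra hne
  -- beyond height `u` the geodesics are disjoint up to `c`, hence everywhere
  have hdisj : ∀ s, u < s → s ≤ a → s ≤ a' → σ s ≠ σ' s := by
    intro s hus hsa hsa' heq
    rcases le_or_gt s c with hsc | hsc
    · exact absurd (humax ⟨⟨by linarith, hsc⟩, heq⟩) (by linarith)
    have hs0 : 0 < s := by linarith
    have hrange := hT.uniquelyArcwise (fun t => σ (s * t)) (fun t => σ' (s * t))
      (hcσ.comp_continuous (by fun_prop) fun t => ⟨mul_nonneg hs0.le t.2.1,
        (mul_le_of_le_one_right hs0.le t.2.2).trans hsa⟩)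
      (hcσ'.comp_continuous (by fun_prop) fun t => ⟨mul_nonneg hs0.le t.2.1,
        (mul_le_of_le_one_right hs0.le t.2.2).trans hsa'⟩)
      (fun t t' h => by
        have h1 := hh (s * t) ⟨mul_nonneg hs0.le t.2.1,
          (mul_le_of_le_one_right hs0.le t.2.2).trans hsa⟩
        have h2 := hh (s * t') ⟨mul_nonneg hs0.le t'.2.1,
          (mul_le_of_le_one_right hs0.le t'.2.2).trans hsa⟩
        simp only at h
        rw [h, h2] at h1
        exact Subtype.ext (mul_left_cancel₀ hs0.ne' h1.symm))
      (fun t t' h => by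
        have h1 := hh' (s * t) ⟨mul_nonneg hs0.le t.2.1,
          (mul_le_of_le_one_right hs0.le t.2.2).trans hsa'⟩
        have h2 := hh' (s * t') ⟨mul_nonneg hs0.le t'.2.1,
          (mul_le_of_le_one_right hs0.le t'.2.2).trans hsa'⟩
        simp only at h
        rw [h, h2] at h1
        exact Subtype.ext (mul_left_cancel₀ hs0.ne' h1.symm))
      (by simpa using h0) (by simpa using heq)
    have hmem : σ c ∈ range (fun t : unitInterval => σ' (s * t)) := by
      rw [← hrange]
      refine ⟨⟨c / s, div_nonneg hc hs0.le, (div_le_one hs0).2 hsc.le⟩, ?_⟩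
      simp only [mul_div_cancel₀ c hs0.ne']
    obtain ⟨t, ht⟩ := hmem
    have := hheight c ⟨hc, hca.le⟩ (s * t) ⟨mul_nonneg hs0.le t.2.1,
      (mul_le_of_le_one_right hs0.le t.2.2).trans hsa'⟩ ht.symm
    simp only at ht
    rw [← this] at ht
    exact hne ht.symm
  -- the concatenation of the two branches is an arc
  set L : ℝ := (a - u) + (a' - u) with hL
  have hLpos : 0 < L := by simp only [hL]; linarith
  let ρ : ℝ → T := fun v => if v ≤ a - u then σ (a - v) else σ' (2 * u - a + v)
  have hρ : ContinuousOn ρ (Icc 0 L) := by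
    refine ContinuousOn.if ?_ ?_ ?_
    · rintro v ⟨hv, hv'⟩
      have : v = a - u := by
        have := frontier_le_subset_eq continuous_id continuous_const hv'
        exact this
      subst this
      rw [sub_sub_cancel, hueq]
      congr 1; ring
    · refine hcσ.comp (by fun_prop) ?_
      rintro v ⟨⟨hv0, hvL⟩, hv⟩
      have hv' : v ≤ a - u := by
        exact closure_minimal (fun _ h => h) (isClosed_le continuous_id continuous_const) hv
      constructor <;> linarith
    · refine hcσ'.comp (by fun_prop) ?_
      rintro v ⟨⟨hv0, hvL⟩, hv⟩
      have hv' : a - u ≤ v := by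
        have : {v : ℝ | ¬ v ≤ a - u} ⊆ {v | a - u ≤ v} := fun v hv => (not_le.1 hv).le
        exact closure_minimal this (isClosed_le continuous_const continuous_id) hv
      constructor <;> linarith
  have hρinj : InjOn ρ (Icc 0 L) := by
    rintro v ⟨hv0, hvL⟩ w ⟨hw0, hwL⟩ hvw
    simp only [ρ] at hvw
    split_ifs at hvw with h1 h2 h2
    · have e1 := hh (a - v) ⟨by linarith, by linarith⟩
      rw [hvw, hh (a - w) ⟨by linarith, by linarith⟩] at e1
      linarith
    · have e := hheight _ ⟨by linarith, by linarith⟩ _ ⟨by linarith, by linarith⟩ hvw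
      rw [← e] at hvw
      exact absurd hvw (hdisj _ (by linarith) (by linarith) (by linarith))
    · have e := hheight _ ⟨by linarith, by linarith⟩ _ ⟨by linarith, by linarith⟩ hvw.symm
      rw [← e] at hvw
      exact absurd hvw.symm (hdisj _ (by linarith) (by linarith) (by linarith))
    · have e1 := hh' (2 * u - a + v) ⟨by linarith, by linarith⟩
      rw [hvw, hh' (2 * u - a + w) ⟨by linarith, by linarith⟩] at e1
      linarith
  have hρ0 : ρ 0 = σ a := by simp only [ρ]; rw [if_pos (by linarith), sub_zero]
  have hρL : ρ L = σ' a' := by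
    simp only [ρ]; rw [if_neg (by simp only [hL]; linarith)]; congr 1; simp only [hL]; ring
  have hρu : ρ (a - u) = σ u := by simp only [ρ]; rw [if_pos le_rfl, sub_sub_cancel]
  have hD : 0 < dist (σ a) (σ' a') := by
    rw [dist_pos, ← hρ0, ← hρL]
    exact fun h => hLpos.ne (hρinj ⟨le_rfl, hLpos.le⟩ ⟨hLpos.le, le_rfl⟩ h)
  obtain ⟨τ, hτ0, hτ1, hτ⟩ := hT.geodesic (σ a) (σ' a')
  set D := dist (σ a) (σ' a') with hDdef
  have hcτ : ContinuousOn τ (Icc 0 D) := (LipschitzOnWith.of_dist_le_mul (K := 1)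
    fun s hs t ht => by simp [hτ s hs t ht, Real.dist_eq]).continuousOn
  have hmemL : ∀ t : unitInterval, L * t ∈ Icc 0 L := fun t =>
    ⟨mul_nonneg hLpos.le t.2.1, mul_le_of_le_one_right hLpos.le t.2.2⟩
  have hmemD : ∀ t : unitInterval, D * t ∈ Icc 0 D := fun t =>
    ⟨mul_nonneg hD.le t.2.1, mul_le_of_le_one_right hD.le t.2.2⟩
  have hrange := hT.uniquelyArcwise (fun t => ρ (L * t)) (fun t => τ (D * t))
    (hρ.comp_continuous (by fun_prop) hmemL) (hcτ.comp_continuous (by fun_prop) hmemD)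
    (fun t t' h => Subtype.ext (mul_left_cancel₀ hLpos.ne' (hρinj (hmemL t) (hmemL t') h)))
    (fun t t' h => by
      have h1 := hτ _ (hmemD t) _ (hmemD t')
      simp only at h
      rw [h, dist_self] at h1
      exact Subtype.ext (mul_left_cancel₀ hD.ne' (sub_eq_zero.1 (abs_eq_zero.1 h1.symm))))
    (by simp [hρ0, hτ0]) (by simp [hρL, hτ1])
  have hmem : σ u ∈ range (fun t : unitInterval => τ (D * t)) := by
    rw [← hrange]
    refine ⟨⟨(a - u) / L, div_nonneg (by linarith) hLpos.le, (div_le_one hLpos).2 ?_⟩, ?_⟩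
    · simp only [hL]; linarith
    · simp only [mul_div_cancel₀ _ hLpos.ne', hρu]
  obtain ⟨t, ht⟩ := hmem
  have e1 := hτ 0 ⟨le_rfl, hD.le⟩ _ (hmemD t)
  have e2 := hσ a ⟨ha0, le_rfl⟩ u ⟨hu0, by linarith⟩
  simp only at ht
  rw [hτ0, ht, e2, zero_sub, abs_neg, abs_of_nonneg (hmemD t).1, abs_of_nonneg (by linarith)] at e1
  linarith [(hmemD t).2]

/-- If a path in an ℝ-tree starts and ends at height `dist o x` over `o` and never goes below
that height, then it is closed. -/
theorem IsRTree.eq_of_forall_le_dist {T : Type} [MetricSpace T] (hT : IsRTree T) (o : T)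
    {S : Set unitInterval} (hS : IsPreconnected S) {p : unitInterval → T}
    (hp : Continuous p) {s t : unitInterval} (hs : s ∈ S) (ht : t ∈ S)
    (hst : dist o (p s) = dist o (p t)) (hle : ∀ r ∈ S, dist o (p s) ≤ dist o (p r)) :
    p s = p t := by
  choose σ hσ0 hσ1 hσ using fun r => hT.geodesic o (p r)
  have key : ∀ c, 0 ≤ c → c < dist o (p s) → dist (p s) (p t) ≤ 2 * (dist o (p s) - c) := by
    intro c hc hcs
    have hconst : σ s c = σ t c := by
      refine hS.induction₂ (fun x y => σ x c = σ y c) (fun x hx => ?_) (fun _ _ _ _ _ _ => Eq.trans)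
        (fun _ _ _ _ => Eq.symm) hs ht
      have hcx : 0 < dist o (p x) - c := by linarith [hle x hx]
      have hev : ∀ᶠ y in 𝓝 x, dist (p x) (p y) < dist o (p x) - c :=
        (isOpen_lt (by fun_prop) continuous_const).mem_nhds (by simpa using hcx)
      filter_upwards [nhdsWithin_le_nhds hev] with y hy
      exact hT.geodesic_eq (hσ x) (hσ y) (by rw [hσ0, hσ0]) hc (by rwa [hσ1, hσ1]) dist_nonneg
    have e1 := hσ s _ ⟨hc, hcs.le⟩ _ ⟨dist_nonneg, le_rfl⟩
    have e2 := hσ t _ ⟨hc, by linarith⟩ _ ⟨dist_nonneg, le_rfl⟩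
    rw [hσ1, abs_sub_comm, abs_of_nonneg (by linarith)] at e1 e2
    have := dist_triangle_left (p s) (p t) (σ s c)
    rw [e1, hconst, e2] at this
    linarith
  have hd := dist_nonneg (x := o) (y := p s)
  rcases hd.eq_or_lt with h | h
  · rw [← dist_eq_zero.1 h.symm, dist_eq_zero.1 (hst.symm.trans h.symm)]
  · by_contra hne
    have hpos : 0 < dist (p s) (p t) := dist_pos.2 hne
    have := key (dist o (p s) - min (dist o (p s)) (dist (p s) (p t) / 3))
      (by linarith [min_le_left (dist o (p s)) (dist (p s) (p t) / 3)])
      (by linarith [lt_min h (by linarith : 0 < dist (p s) (p t) / 3)])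
    linarith [min_le_right (dist o (p s)) (dist (p s) (p t) / 3)]

/-- The minimum of `h` between `s` and `t`. -/
def lowest (h : C(unitInterval, ℝ)) (s t : unitInterval) : ℝ := sInf (h '' uIcc s t)

section Lowest

variable (h : C(unitInterval, ℝ)) {s t u : unitInterval} {c : ℝ}

theorem exists_eq_lowest (s t : unitInterval) :
    ∃ r ∈ uIcc s t, h r = lowest h s t ∧ ∀ w ∈ uIcc s t, h r ≤ h w := by
  obtain ⟨r, hr, hmin⟩ := isCompact_uIcc.exists_isMinOn (nonempty_uIcc (a := s) (b := t))
    h.continuous.continuousOn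
  have hl : IsLeast (h '' uIcc s t) (h r) :=
    ⟨mem_image_of_mem h hr, forall_mem_image.2 fun w hw => hmin hw⟩
  exact ⟨r, hr, hl.csInf_eq.symm, fun w hw => hmin hw⟩

variable {h} in
theorem le_lowest_iff : c ≤ lowest h s t ↔ ∀ w ∈ uIcc s t, c ≤ h w := by
  obtain ⟨r, hr, hrl, hmin⟩ := exists_eq_lowest h s t
  rw [← hrl]
  exact ⟨fun hc w hw => hc.trans (hmin w hw), fun hc => hc r hr⟩

variable {h} in
theorem lowest_le {w : unitInterval} (hw : w ∈ uIcc s t) : lowest h s t ≤ h w :=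
  le_lowest_iff.1 le_rfl w hw

theorem lowest_comm (s t : unitInterval) : lowest h s t = lowest h t s := by
  rw [lowest, uIcc_comm, lowest]

@[simp]
theorem lowest_self (s : unitInterval) : lowest h s s = h s := by
  simp [lowest]

theorem lowest_le_left (s t : unitInterval) : lowest h s t ≤ h s := lowest_le left_mem_uIcc

theorem lowest_le_right (s t : unitInterval) : lowest h s t ≤ h t := lowest_le right_mem_uIcc

variable {h} in
theorem le_lowest_trans (h₁ : c ≤ lowest h s t) (h₂ : c ≤ lowest h t u) : c ≤ lowest h s u := by
  rw [le_lowest_iff] at *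
  exact fun w hw => (uIcc_subset_uIcc_union_uIcc hw).elim (h₁ w) (h₂ w)

theorem min_lowest_le (s t u : unitInterval) :
    min (lowest h s t) (lowest h t u) ≤ lowest h s u :=
  le_lowest_trans (min_le_left _ _) (min_le_right _ _)

variable {h} in
/-- Every height between the minimum of `h` on `[r, t]` and `h t` is attained by an ancestor
of `t` lying between `r` and `t`. -/
theorem exists_ancestor {r t : unitInterval} (h₁ : lowest h r t ≤ c) (h₂ : c ≤ h t) :
    ∃ y ∈ uIcc r t, h y = c ∧ lowest h y t = c := by
  have ivt : ∀ z, h z ≤ c → ∃ y ∈ uIcc z t, h y = c := fun z hz => by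
    obtain ⟨y, hy, hyc⟩ := isPreconnected_uIcc.intermediate_value (left_mem_uIcc (a := z) (b := t))
      right_mem_uIcc h.continuous.continuousOn ⟨hz, h₂⟩
    exact ⟨y, hy, hyc⟩
  obtain ⟨r', hr', hr'l, -⟩ := exists_eq_lowest h r t
  obtain ⟨y₀, hy₀, hy₀c⟩ := ivt r' (hr'l.trans_le h₁)
  have hcomp : IsCompact (uIcc r t ∩ h ⁻¹' {c}) :=
    isCompact_uIcc.inter_right (isClosed_singleton.preimage h.continuous)
  obtain ⟨y, ⟨hy, hyc⟩, hmin⟩ := hcomp.exists_isMinOn (f := fun y => dist y t)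
    ⟨y₀, uIcc_subset_uIcc_right hr' hy₀, hy₀c⟩ (by fun_prop)
  refine ⟨y, hy, hyc, le_antisymm ((lowest_le_left h y t).trans_eq hyc) ?_⟩
  rw [le_lowest_iff]
  intro z hz
  by_contra! hzc
  obtain ⟨w, hw, hwc⟩ := ivt z hzc.le
  have hwy : dist y t ≤ dist w t :=
    hmin ⟨uIcc_subset_uIcc_right hy (uIcc_subset_uIcc_right hz hw), hwc⟩
  have hyc' : h y = c := hyc
  have hzy : z ≠ y := by rintro rfl; linarith
  simp only [Subtype.dist_eq, Real.dist_eq] at hwy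
  have hne : (z : ℝ) ≠ y := fun e => hzy (Subtype.ext e)
  rw [mem_uIcc, ← Subtype.coe_le_coe, ← Subtype.coe_le_coe, ← Subtype.coe_le_coe,
    ← Subtype.coe_le_coe] at hz hw
  have hzyt : z ≠ t := by rintro rfl; linarith
  rcases hz with ⟨h1, h2⟩ | ⟨h1, h2⟩ <;> rcases hw with ⟨h3, h4⟩ | ⟨h3, h4⟩
  · have := lt_of_le_of_ne h1 hne.symm
    rw [abs_of_nonpos (by linarith), abs_of_nonpos (by linarith)] at hwy
    linarith
  · exact hzyt (Subtype.ext (by linarith))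
  · exact hzyt (Subtype.ext (by linarith))
  · have := lt_of_le_of_ne h2 hne
    rw [abs_of_nonneg (by linarith), abs_of_nonneg (by linarith)] at hwy
    linarith

end Lowest

/-- The unit interval with the pseudometric of the ℝ-tree with contour function `h`. -/
structure Contour (h : C(unitInterval, ℝ)) where
  /-- The underlying point of the unit interval. -/
  point : unitInterval

namespace Contour

variable (h : C(unitInterval, ℝ))

instance : PseudoMetricSpace (Contour h) where
  dist s t := h s.point + h t.point - 2 * lowest h s.point t.point
  dist_self s := by rw [lowest_self]; ring
  dist_comm s t := by rw [lowest_comm]; ring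
  dist_triangle s t u := by
    have h₁ := lowest_le_right h s.point t.point
    have h₂ := lowest_le_left h t.point u.point
    rcases min_le_iff.1 (min_lowest_le h s.point t.point u.point) with h₃ | h₃ <;> linarith

/-- The ℝ-tree with contour function `h`. -/
abbrev Tree : Type := SeparationQuotient (Contour h)

/-- The canonical loop around the ℝ-tree with contour function `h`. -/
def toTree (s : unitInterval) : Tree h := SeparationQuotient.mk (⟨s⟩ : Contour h)

theorem dist_toTree (s t : unitInterval) :
    dist (toTree h s) (toTree h t) = h s + h t - 2 * lowest h s t := rfl

theorem surjective_toTree : Function.Surjective (toTree h) := fun x => by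
  obtain ⟨s, rfl⟩ := SeparationQuotient.surjective_mk x
  exact ⟨s.point, rfl⟩

theorem toTree_eq_iff {s t : unitInterval} :
    toTree h s = toTree h t ↔ h s = h t ∧ lowest h s t = h s := by
  rw [← dist_eq_zero, dist_toTree]
  have h₁ := lowest_le_left h s t
  have h₂ := lowest_le_right h s t
  constructor
  · intro h; constructor <;> linarith
  · rintro ⟨h₃, h₄⟩; linarith

theorem continuous_toTree : Continuous (toTree h) := by
  rw [Metric.continuous_iff]
  intro s ε hε
  obtain ⟨δ, hδ, H⟩ := Metric.continuous_iff.1 h.continuous s (ε / 4) (by positivity)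
  refine ⟨δ, hδ, fun t ht => ?_⟩
  have hlow : h s - ε / 4 ≤ lowest h t s := by
    rw [le_lowest_iff]
    intro w hw
    have hws : dist w s ≤ dist t s := by
      have : (w : ℝ) ∈ uIcc (t : ℝ) s := by
        rw [mem_uIcc] at hw ⊢
        exact hw
      have := abs_sub_right_of_mem_uIcc this
      rw [Subtype.dist_eq, Subtype.dist_eq, Real.dist_eq, Real.dist_eq, abs_sub_comm,
        abs_sub_comm (t : ℝ)]
      exact this
    have := H w (hws.trans_lt ht)
    rw [Real.dist_eq, abs_lt] at this
    linarith
  have := H t ht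
  rw [Real.dist_eq, abs_lt] at this
  rw [dist_toTree]
  linarith

theorem isRTree_tree : IsRTree (Tree h) := by
  have : Nonempty (Tree h) := ⟨toTree h 0⟩
  refine isRTree_of_geodesic_of_trans ?_ ?_
  · intro x y
    obtain ⟨s, rfl⟩ := surjective_toTree h x
    obtain ⟨t, rfl⟩ := surjective_toTree h y
    set d := dist (toTree h s) (toTree h t) with hd
    set m := lowest h s t with hm
    rw [dist_toTree] at hd
    have hms := lowest_le_left h s t
    have hmt := lowest_le_right h s t
    have hs : ∀ v : ℝ, ∃ a : unitInterval, v ∈ Icc 0 (h s - m) →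
        h a = h s - v ∧ lowest h a s = h s - v := fun v => by
      by_cases hv : v ∈ Icc 0 (h s - m)
      · obtain ⟨a, -, ha⟩ := exists_ancestor (h := h) (r := t) (t := s) (c := h s - v)
          (by rw [lowest_comm]; linarith [hv.2]) (by linarith [hv.1])
        exact ⟨a, fun _ => ha⟩
      · exact ⟨0, fun h => absurd h hv⟩
    have ht : ∀ v : ℝ, ∃ a : unitInterval, v ∈ Icc (h s - m) d →
        h a = h t + v - d ∧ lowest h a t = h t + v - d := fun v => by
      by_cases hv : v ∈ Icc (h s - m) d
      · obtain ⟨a, -, ha⟩ := exists_ancestor (h := h) (r := s) (t := t) (c := h t + v - d)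
          (by linarith [hv.1]) (by linarith [hv.2])
        exact ⟨a, fun _ => ha⟩
      · exact ⟨0, fun h => absurd h hv⟩
    choose a ha using hs
    choose b hb using ht
    refine ⟨fun v => if v ≤ h s - m then toTree h (a v) else toTree h (b v), ?_, ?_, ?_⟩
    · beta_reduce
      rw [if_pos (by linarith), toTree_eq_iff]
      obtain ⟨h1, h2⟩ := ha 0 ⟨le_rfl, by linarith⟩
      constructor <;> linarith
    · beta_reduce
      split_ifs with hdm
      · obtain ⟨h1, h2⟩ := ha d ⟨dist_nonneg, hdm⟩
        have h3 := lowest_le_left h (a d) t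
        have h4 : m ≤ lowest h (a d) t := le_lowest_trans (t := s) (by linarith) le_rfl
        rw [toTree_eq_iff]
        constructor <;> linarith
      · obtain ⟨h1, h2⟩ := hb d ⟨(not_le.1 hdm).le, le_rfl⟩
        rw [toTree_eq_iff]
        constructor <;> linarith
    · have key : ∀ u ∈ Icc 0 d, ∀ v ∈ Icc 0 d, u ≤ v →
          dist (if u ≤ h s - m then toTree h (a u) else toTree h (b u))
            (if v ≤ h s - m then toTree h (a v) else toTree h (b v)) = v - u := by
        intro u hu v hv huv
        split_ifs with h1 h2 h2
        · obtain ⟨h3, h4⟩ := ha u ⟨hu.1, h1⟩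
          obtain ⟨h5, h6⟩ := ha v ⟨hv.1, h2⟩
          have h7 : h (a v) ≤ lowest h (a u) (a v) :=
            le_lowest_trans (t := s) (by linarith) (by rw [lowest_comm]; linarith)
          have h8 := lowest_le_right h (a u) (a v)
          rw [dist_toTree]
          linarith
        · obtain ⟨h3, h4⟩ := ha u ⟨hu.1, h1⟩
          obtain ⟨h5, h6⟩ := hb v ⟨(not_le.1 h2).le, hv.2⟩
          have h7 : m ≤ lowest h (a u) (b v) :=
            le_lowest_trans (t := s) (by linarith)
              (le_lowest_trans (t := t) le_rfl (by rw [lowest_comm]; linarith))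
          have h8 : lowest h (a u) (b v) ≤ m := by
            by_contra! h9
            have h10 := lowest_le_left h (a u) (b v)
            have : min (lowest h (a u) (b v)) (min (h (a u)) (h (b v))) ≤ m :=
              le_lowest_trans (t := a u) (by
                rw [lowest_comm h s, h4, ← h3]; exact (min_le_right _ _).trans (min_le_left _ _))
                (le_lowest_trans (t := b v) (min_le_left _ _) (by
                  rw [h6, ← h5]; exact (min_le_right _ _).trans (min_le_right _ _)))
            rw [min_le_iff, min_le_iff] at this
            rcases this with h | h | h <;> linarith
          rw [dist_toTree]
          linarith
        · linarith
        · obtain ⟨h3, h4⟩ := hb u ⟨(not_le.1 h1).le, hu.2⟩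
          obtain ⟨h5, h6⟩ := hb v ⟨(not_le.1 h2).le, hv.2⟩
          have h7 : h (b u) ≤ lowest h (b u) (b v) :=
            le_lowest_trans (t := t) (by linarith) (by rw [lowest_comm]; linarith)
          have h8 := lowest_le_left h (b u) (b v)
          rw [dist_toTree]
          linarith
      intro u hu v hv
      rcases le_total u v with huv | huv
      · rw [abs_sub_comm, abs_of_nonneg (sub_nonneg.2 huv)]
        exact key u hu v hv huv
      · rw [abs_of_nonneg (sub_nonneg.2 huv), dist_comm]
        exact key v hv u hu huv
  · intro z a b c hab hbc
    obtain ⟨z, rfl⟩ := surjective_toTree h z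
    obtain ⟨a, rfl⟩ := surjective_toTree h a
    obtain ⟨b, rfl⟩ := surjective_toTree h b
    obtain ⟨c, rfl⟩ := surjective_toTree h c
    simp only [dist_toTree, lowest_comm h z] at *
    have h1 := min_le_iff.1 (min_lowest_le h a b c)
    have h2 := min_le_iff.1 (min_lowest_le h a z c)
    have h3 := min_le_iff.1 (min_lowest_le h b c z)
    have h4 := min_le_iff.1 (min_lowest_le h a b z)
    have h5 := min_le_iff.1 (min_lowest_le h b a z)
    have h6 := min_le_iff.1 (min_lowest_le h c b z)
    have h7 := lowest_le_right h a z
    have h8 := lowest_le_right h b z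
    have h9 := lowest_le_right h c z
    rw [lowest_comm h z c] at h2
    rw [lowest_comm h b a] at h5
    rw [lowest_comm h c b] at h6
    grind

end Contour

/-- `h` is a contour function for `γ` if `γ` takes the same value at any two times that `h`
identifies in its ℝ-tree. -/
def IsContourOf {X : Type*} (h : C(unitInterval, ℝ)) (γ : unitInterval → X) : Prop :=
  ∀ s t, h s = h t → lowest h s t = h s → γ s = γ t

/-- A loop factors through an ℝ-tree if and only if it has a contour function that is minimal at
the endpoints. -/
theorem exists_rTree_factorization_iff {X : Type*} [TopologicalSpace X] {γ : unitInterval → X}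
    (hγ : Continuous γ) :
    (∃ (T : Type) (_ : MetricSpace T), IsRTree T ∧
      ∃ (f : T → X) (ℓ : unitInterval → T),
        Continuous f ∧ Continuous ℓ ∧ ℓ 0 = ℓ 1 ∧ f ∘ ℓ = γ) ↔
    ∃ h : C(unitInterval, ℝ), (∀ t, h 0 ≤ h t) ∧ (∀ t, h 1 ≤ h t) ∧ IsContourOf h γ := by
  constructor
  · rintro ⟨T, _, hT, f, ℓ, hf, hℓ, hloop, rfl⟩
    refine ⟨⟨fun t => dist (ℓ 0) (ℓ t), by fun_prop⟩, fun t => ?_, fun t => ?_, fun s t hst hl => ?_⟩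
    · simp [dist_nonneg]
    · simp [← hloop, dist_nonneg]
    · exact congrArg f (hT.eq_of_forall_le_dist (ℓ 0) isPreconnected_uIcc hℓ
        (left_mem_uIcc (a := s) (b := t)) right_mem_uIcc hst (le_lowest_iff.1 hl.ge))
  · rintro ⟨h, h0, h1, hc⟩
    have hsurj := Contour.surjective_toTree h
    have hquot : IsQuotientMap (Contour.toTree h) :=
      (Contour.continuous_toTree h).isClosedMap.isQuotientMap (Contour.continuous_toTree h) hsurj
    have hfac : (γ ∘ Function.surjInv hsurj) ∘ Contour.toTree h = γ := by
      funext t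
      obtain ⟨e1, e2⟩ := (Contour.toTree_eq_iff h).1
        (Function.surjInv_eq hsurj (Contour.toTree h t))
      exact hc _ _ e1 e2
    refine ⟨Contour.Tree h, inferInstance, Contour.isRTree_tree h, γ ∘ Function.surjInv hsurj,
      Contour.toTree h, ?_, Contour.continuous_toTree h, ?_, hfac⟩
    · rw [hquot.continuous_iff, hfac]
      exact hγ
    · rw [Contour.toTree_eq_iff]
      exact ⟨le_antisymm (h0 1) (h1 0), le_antisymm (lowest_le_left h 0 1)
        (le_lowest_iff.2 fun w _ => h0 w)⟩

/-- The fibres of a path in a Hausdorff space are the fibres of a path in a metrizable space. -/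
theorem exists_continuous_real_sequence_eq_iff {X : Type*} [TopologicalSpace X] [T2Space X]
    {γ : unitInterval → X} (hγ : Continuous γ) :
    ∃ Φ : unitInterval → ℕ → ℝ, Continuous Φ ∧ ∀ s t, Φ s = Φ t ↔ γ s = γ t := by
  let γ' : C(unitInterval, range γ) := ⟨rangeFactorization γ, hγ.rangeFactorization⟩
  have : CompactSpace (range γ) := isCompact_iff_compactSpace.1 (isCompact_range hγ)
  let S : Set C(unitInterval, ℝ) := range fun F : C(range γ, ℝ) => F.comp γ'
  have : Nonempty S := ⟨⟨_, mem_range_self 0⟩⟩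
  refine ⟨fun s n => (TopologicalSpace.denseSeq S n : C(unitInterval, ℝ)) s, by fun_prop,
    fun s t => ⟨fun h => ?_, fun h => ?_⟩⟩
  · by_contra hne
    obtain ⟨F, hF0, hF1, -⟩ := exists_continuous_zero_one_of_isClosed
      (isClosed_singleton (x := γ' s)) (isClosed_singleton (x := γ' t))
      (by simpa [γ', rangeFactorization] using hne)
    have hmem : F.comp γ' ∈ S := mem_range_self F
    obtain ⟨n, hn⟩ := (TopologicalSpace.denseRange_denseSeq S).exists_dist_lt ⟨_, hmem⟩
      (by norm_num : (0 : ℝ) < 1 / 2)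
    have h1 := (ContinuousMap.dist_apply_le_dist s).trans_lt hn
    have h2 := (ContinuousMap.dist_apply_le_dist t).trans_lt hn
    have h3 : F (γ' s) = 0 := hF0 rfl
    have h4 : F (γ' t) = 1 := hF1 rfl
    have h5 := congrFun h n
    simp only [ContinuousMap.comp_apply, h3, h4, Real.dist_eq, abs_lt] at h1 h2
    linarith [h1.1, h2.2]
  · funext n
    obtain ⟨F, hF⟩ := (TopologicalSpace.denseSeq S n).2
    have : γ' s = γ' t := Subtype.ext h
    simp only [← hF, ContinuousMap.comp_apply, this]

section Reach

variable {M : Type*} [PseudoMetricSpace M]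

/-- The largest distance from `φ q` attained by `φ` on the part above `t` of the branch ending
at `q` in the ℝ-tree with contour function `h`. -/
def reach (h : C(unitInterval, ℝ)) (φ : unitInterval → M) (t q : unitInterval) : ℝ :=
  sSup ((fun x => dist (φ x) (φ q)) '' {x | lowest h x q = h x ∧ lowest h t q ≤ h x})

variable {h : C(unitInterval, ℝ)} {φ : unitInterval → M} {r s t q x : unitInterval} {c : ℝ}

theorem le_reach (hφ : Continuous φ) (h₁ : lowest h x q = h x) (h₂ : lowest h t q ≤ h x) :
    dist (φ x) (φ q) ≤ reach h φ t q := by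
  refine le_csSup ⟨Metric.diam (range φ), ?_⟩ (mem_image_of_mem _ ⟨h₁, h₂⟩)
  rintro _ ⟨y, -, rfl⟩
  exact Metric.dist_le_diam_of_mem (isCompact_range hφ).isBounded (mem_range_self y)
    (mem_range_self q)

theorem reach_le (hc : ∀ x, lowest h x q = h x → lowest h t q ≤ h x → dist (φ x) (φ q) ≤ c) :
    reach h φ t q ≤ c := by
  refine csSup_le ⟨_, mem_image_of_mem _ ⟨lowest_self h q, lowest_le_right h t q⟩⟩ ?_
  rintro _ ⟨y, ⟨h₁, h₂⟩, rfl⟩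
  exact hc y h₁ h₂

theorem reach_nonneg (hφ : Continuous φ) : 0 ≤ reach h φ t q := by
  simpa using le_reach hφ (lowest_self h q) (lowest_le_right h t q)

theorem reach_le_diam (hφ : Continuous φ) : reach h φ t q ≤ Metric.diam (range φ) :=
  reach_le fun x _ _ => Metric.dist_le_diam_of_mem (isCompact_range hφ).isBounded
    (mem_range_self x) (mem_range_self q)

theorem dist_le_reach (hφ : Continuous φ) (hrt : lowest h r t = h r) :
    dist (φ r) (φ t) ≤ reach h φ r t :=
  le_reach hφ hrt hrt.le

theorem reach_anti (hφ : Continuous φ) (hrt : lowest h r t = h r) :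
    reach h φ t q ≤ reach h φ r q := by
  refine reach_le fun x h₁ h₂ => le_reach hφ h₁ (le_trans ?_ h₂)
  refine le_lowest_trans (t := r) ?_ le_rfl
  rw [lowest_comm h t r, hrt]
  exact lowest_le_left h r q

theorem IsContourOf.reach_self (hc : IsContourOf h φ) (hφ : Continuous φ) :
    reach h φ t t = 0 := by
  refine le_antisymm (reach_le fun x h₁ h₂ => ?_) (reach_nonneg hφ)
  rw [lowest_self] at h₂
  rw [hc x t (le_antisymm (h₁.ge.trans (lowest_le_right h x t)) h₂) h₁, dist_self]

theorem IsContourOf.reach_eq (hc : IsContourOf h φ) (hφ : Continuous φ)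
    (hrt : lowest h r t = h r) (hconst : ∀ y ∈ uIcc r t, φ y = φ t) :
    reach h φ r q = reach h φ t q := by
  refine le_antisymm (reach_le fun x h₁ h₂ => ?_) (reach_anti hφ hrt)
  rcases le_or_gt (lowest h t q) (h x) with h₃ | h₃
  · exact le_reach hφ h₁ h₃
  have hrx : h r ≤ h x := by
    by_contra! hlt
    refine (lt_min hlt h₃).not_ge ((le_lowest_trans (t := t) ?_ ?_).trans h₂)
    · rw [hrt]; exact min_le_left _ _
    · exact min_le_right _ _
  -- the branch ending at `q` is constant between `r` and `t`
  have key : ∀ y, lowest h y q = h y → h r ≤ h y → h y ≤ lowest h t q → φ y = φ t := by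
    intro y h₄ h₅ h₆
    obtain ⟨z, hz, hzy, hzt⟩ := exists_ancestor (h := h) (r := r) (t := t) (c := h y)
      (hrt.trans_le h₅) (h₆.trans (lowest_le_left h t q))
    rw [← hconst z hz]
    refine hc y z hzy.symm (le_antisymm (lowest_le_left h y z) ?_)
    refine le_lowest_trans (t := q) h₄.ge (le_lowest_trans (t := t) ?_ ?_)
    · rwa [lowest_comm]
    · rw [lowest_comm, hzt]
  obtain ⟨x', -, h₄, h₅⟩ := exists_ancestor (h := h) (r := t) (t := q) le_rfl
    (lowest_le_right h t q)
  rw [key x h₁ hrx h₃.le, ← key x' (h₅.trans h₄.symm) (by linarith) h₄.le]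
  exact le_reach hφ (h₅.trans h₄.symm) h₄.ge

open Contour in
theorem IsContourOf.exists_dist_lt (hc : IsContourOf h φ) (hφ : Continuous φ) {ε : ℝ}
    (hε : 0 < ε) :
    ∃ δ > 0, ∀ s t, dist (toTree h s) (toTree h t) < δ → dist (φ s) (φ t) < ε := by
  have hT := continuous_toTree h
  set K : Set (unitInterval × unitInterval) := {p | ε ≤ dist (φ p.1) (φ p.2)} with hK
  have hKc : IsCompact K := (isClosed_le continuous_const (by fun_prop)).isCompact
  rcases K.eq_empty_or_nonempty with hK0 | hK0
  · refine ⟨1, one_pos, fun s t _ => ?_⟩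
    by_contra! hle
    exact hK0.subset (show (s, t) ∈ K from hle)
  · obtain ⟨⟨a, b⟩, hab, hmin⟩ := hKc.exists_isMinOn
      (f := fun p => dist (toTree h p.1) (toTree h p.2)) hK0 (by fun_prop)
    refine ⟨dist (toTree h a) (toTree h b), dist_pos.2 fun heq => ?_, fun s t hst => ?_⟩
    · obtain ⟨h₁, h₂⟩ := (toTree_eq_iff h).1 heq
      have hab' : ε ≤ dist (φ a) (φ b) := hab
      rw [hc a b h₁ h₂, dist_self] at hab'
      linarith
    · by_contra! hle
      exact (hmin (show (s, t) ∈ K from hle)).not_gt hst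

open Contour in
theorem IsContourOf.continuous_reach (hc : IsContourOf h φ) (hφ : Continuous φ) :
    Continuous fun p : unitInterval × unitInterval => reach h φ p.1 p.2 := by
  have hT := continuous_toTree h
  have key : ∀ ε > 0, ∃ δ > 0, ∀ t t' q q', dist (toTree h t) (toTree h t') < δ →
      dist (toTree h q) (toTree h q') < δ → reach h φ t q ≤ reach h φ t' q' + 2 * ε := by
    intro ε hε
    obtain ⟨δ, hδ, H⟩ := hc.exists_dist_lt hφ hε
    refine ⟨δ / 3, by positivity, fun t t' q q' ht hq => reach_le fun x h₁ h₂ => ?_⟩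
    obtain ⟨x', -, h₃, h₄⟩ := exists_ancestor (h := h) (r := t') (t := q')
      (c := max (lowest h t' q') (min (h x) (h q'))) (le_max_left _ _)
      (max_le (lowest_le_right h t' q') (min_le_right _ _))
    have hx' : dist (φ x') (φ q') ≤ reach h φ t' q' :=
      le_reach hφ (h₄.trans h₃.symm) ((le_max_left _ _).trans_eq h₃.symm)
    have hqq : dist (φ q') (φ q) < ε := H _ _ (by rw [dist_comm]; linarith)
    have hxx : dist (φ x) (φ x') < ε := by
      apply H
      rw [dist_toTree] at ht hq ⊢
      have a1 : min (h x) (min (lowest h q q') (h x')) ≤ lowest h x x' :=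
        le_lowest_trans (t := q) (by rw [h₁]; exact min_le_left _ _)
          (le_lowest_trans (t := q') ((min_le_right _ _).trans (min_le_left _ _))
            (by rw [lowest_comm h q' x', h₄, ← h₃]; exact (min_le_right _ _).trans (min_le_right _ _)))
      have a2 : min (lowest h t' t) (min (lowest h t q) (lowest h q q')) ≤ lowest h t' q' :=
        le_lowest_trans (t := t) (min_le_left _ _)
          (le_lowest_trans (t := q) ((min_le_right _ _).trans (min_le_left _ _))
            ((min_le_right _ _).trans (min_le_right _ _)))
      have a2' : min (lowest h t' t) (min (lowest h t' q') (lowest h q q')) ≤ lowest h t q := by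
        rw [lowest_comm h t' t, lowest_comm h q q']
        exact le_lowest_trans (t := t') (min_le_left _ _)
          (le_lowest_trans (t := q') ((min_le_right _ _).trans (min_le_left _ _))
            ((min_le_right _ _).trans (min_le_right _ _)))
      rw [lowest_comm h t' t] at a2 a2'
      have b1 := lowest_le_left h t t'
      have b2 := lowest_le_right h t t'
      have b3 := lowest_le_left h q q'
      have b4 := lowest_le_right h q q'
      have b5 := lowest_le_left h t q
      have b6 := lowest_le_right h t q
      have b7 := lowest_le_left h t' q'
      have b8 := lowest_le_right h t' q'
      have b9 : h x ≤ h q := h₁.ge.trans (lowest_le_right h x q)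
      clear H hqq hx' h₁ h₄
      grind
    calc dist (φ x) (φ q) ≤ dist (φ x) (φ x') + dist (φ x') (φ q') + dist (φ q') (φ q) :=
          dist_triangle4 _ _ _ _
      _ ≤ reach h φ t' q' + 2 * ε := by linarith
  rw [Metric.continuous_iff']
  rintro ⟨t, q⟩ ε hε
  obtain ⟨δ, hδ, H⟩ := key (ε / 3) (by positivity)
  have e1 : ∀ᶠ p : unitInterval × unitInterval in 𝓝 (t, q),
      dist (toTree h p.1) (toTree h t) < δ :=
    (isOpen_lt (by fun_prop) continuous_const).mem_nhds (by simpa using hδ)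
  have e2 : ∀ᶠ p : unitInterval × unitInterval in 𝓝 (t, q),
      dist (toTree h p.2) (toTree h q) < δ :=
    (isOpen_lt (by fun_prop) continuous_const).mem_nhds (by simpa using hδ)
  filter_upwards [e1, e2] with p hp1 hp2
  have := H _ _ _ _ hp1 hp2
  rw [dist_comm] at hp1 hp2
  have := H _ _ _ _ hp1 hp2
  rw [Real.dist_eq, abs_lt]
  constructor <;> linarith

theorem IsContourOf.continuous_reach_left (hc : IsContourOf h φ) (hφ : Continuous φ)
    (q : unitInterval) : Continuous fun t => reach h φ t q :=
  (hc.continuous_reach hφ).comp (f := fun t => (t, q)) (by fun_prop)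

theorem IsContourOf.continuous_reach_right (hc : IsContourOf h φ) (hφ : Continuous φ)
    (t : unitInterval) : Continuous fun q => reach h φ t q :=
  (hc.continuous_reach hφ).comp (f := fun q => (t, q)) (by fun_prop)

/-- The height function of the ℝ-tree obtained by collapsing all arcs along which `φ` is
constant. -/
def collapsedHeight (h : C(unitInterval, ℝ)) (φ : unitInterval → M) (t : unitInterval) : ℝ :=
  -∑' n, (1 / 2 : ℝ) ^ n * reach h φ t (TopologicalSpace.denseSeq unitInterval n)

theorem IsContourOf.continuous_collapsedHeight (hc : IsContourOf h φ) (hφ : Continuous φ) :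
    Continuous (collapsedHeight h φ) := by
  refine (continuous_tsum (u := fun n => (1 / 2 : ℝ) ^ n * Metric.diam (range φ)) (fun n => ?_)
    (summable_geometric_two.mul_right _) fun n t => ?_).neg
  · exact continuous_const.mul (hc.continuous_reach_left hφ _)
  · rw [Real.norm_of_nonneg (mul_nonneg (by positivity) (reach_nonneg hφ))]
    exact mul_le_mul_of_nonneg_left (reach_le_diam hφ) (by positivity)

theorem summable_reach (hφ : Continuous φ) (t : unitInterval) : Summable fun n =>
    (1 / 2 : ℝ) ^ n * reach h φ t (TopologicalSpace.denseSeq unitInterval n) :=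
  .of_nonneg_of_le (fun n => mul_nonneg (by positivity) (reach_nonneg hφ))
    (fun n => mul_le_mul_of_nonneg_left (reach_le_diam hφ) (by positivity))
    (summable_geometric_two.mul_right (Metric.diam (range φ)))

theorem collapsedHeight_mono (hφ : Continuous φ) (hrt : lowest h r t = h r) :
    collapsedHeight h φ r ≤ collapsedHeight h φ t :=
  neg_le_neg (Summable.tsum_le_tsum (fun n => mul_le_mul_of_nonneg_left (reach_anti hφ hrt)
    (by positivity)) (summable_reach hφ t) (summable_reach hφ r))

theorem IsContourOf.collapsedHeight_eq (hc : IsContourOf h φ) (hφ : Continuous φ)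
    (hrt : lowest h r t = h r) (hconst : ∀ y ∈ uIcc r t, φ y = φ t) :
    collapsedHeight h φ r = collapsedHeight h φ t := by
  simp only [collapsedHeight, hc.reach_eq hφ hrt hconst]

theorem IsContourOf.dist_eq_zero_of_collapsedHeight_le (hc : IsContourOf h φ)
    (hφ : Continuous φ) (hrt : lowest h r t = h r)
    (hle : collapsedHeight h φ t ≤ collapsedHeight h φ r) : dist (φ r) (φ t) = 0 := by
  by_contra hne
  have hlt : reach h φ t t < reach h φ r t := by
    rw [hc.reach_self hφ]
    exact (lt_of_le_of_ne dist_nonneg (Ne.symm hne)).trans_le (dist_le_reach hφ hrt)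
  have hopen : IsOpen {q | reach h φ t q < reach h φ r q} :=
    isOpen_lt (hc.continuous_reach_right hφ t) (hc.continuous_reach_right hφ r)
  obtain ⟨n, hn⟩ := (TopologicalSpace.denseRange_denseSeq unitInterval).exists_mem_open hopen
    ⟨t, hlt⟩
  have := Summable.tsum_lt_tsum (fun n => mul_le_mul_of_nonneg_left (reach_anti hφ hrt)
    (by positivity)) (mul_lt_mul_of_pos_left hn (by positivity : (0 : ℝ) < (1 / 2) ^ n))
    (summable_reach hφ t) (summable_reach hφ r)
  exact (neg_lt_neg this).not_ge hle

end Reach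

theorem Monotone.unitInterval_map_zero {g : unitInterval → unitInterval} (hm : Monotone g)
    (hs : Function.Surjective g) : g 0 = 0 := by
  obtain ⟨a, ha⟩ := hs 0
  exact le_antisymm ((hm (unitInterval.nonneg' : 0 ≤ a)).trans_eq ha) unitInterval.nonneg'

theorem Monotone.unitInterval_map_one {g : unitInterval → unitInterval} (hm : Monotone g)
    (hs : Function.Surjective g) : g 1 = 1 := by
  obtain ⟨a, ha⟩ := hs 1
  exact le_antisymm unitInterval.le_one' (ha.ge.trans (hm (unitInterval.le_one' : a ≤ 1)))

/-- A path has a contour function as soon as some monotone reparameterization of it does. -/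
theorem IsContourOf.exists_of_comp {M : Type*} [MetricSpace M] {Φ : unitInterval → M}
    (hΦ : Continuous Φ) {g : unitInterval → unitInterval} (hg : Continuous g) (hm : Monotone g)
    (hs : Function.Surjective g) {h : C(unitInterval, ℝ)} (hc : IsContourOf h (Φ ∘ g))
    (h0 : ∀ t, h 0 ≤ h t) (h1 : ∀ t, h 1 ≤ h t) :
    ∃ h' : C(unitInterval, ℝ), (∀ t, h' 0 ≤ h' t) ∧ (∀ t, h' 1 ≤ h' t) ∧ IsContourOf h' Φ := by
  have hφ : Continuous (Φ ∘ g) := hΦ.comp hg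
  set H := collapsedHeight h (Φ ∘ g) with hH
  have hfib : ∀ s t, g s = g t → H s = H t := by
    intro s t hst
    obtain ⟨r, hr, hrl, hmin⟩ := exists_eq_lowest h s t
    have hgc : ∀ y ∈ uIcc s t, g y = g t := by
      intro y hy
      have := hm.mapsTo_uIcc hy
      rwa [hst, uIcc_self] at this
    have aux : ∀ u ∈ uIcc s t, H r = H u := fun u hu => by
      refine hc.collapsedHeight_eq hφ (le_antisymm (lowest_le_left h r u)
        (le_lowest_iff.2 fun w hw => hmin w (uIcc_subset_uIcc hr hu hw))) fun y hy => ?_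
      rw [Function.comp_apply, Function.comp_apply, hgc y (uIcc_subset_uIcc hr hu hy), hgc u hu]
    rw [← aux s left_mem_uIcc, aux t right_mem_uIcc]
  have hfac : (H ∘ Function.surjInv hs) ∘ g = H :=
    funext fun t => hfib _ _ (Function.surjInv_eq hs (g t))
  have hcont : Continuous (H ∘ Function.surjInv hs) := by
    rw [(hg.isClosedMap.isQuotientMap hg hs).continuous_iff, hfac]
    exact hc.continuous_collapsedHeight hφ
  have happ : ∀ t, (H ∘ Function.surjInv hs) (g t) = H t := congrFun hfac
  have hg0 := hm.unitInterval_map_zero hs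
  have hg1 := hm.unitInterval_map_one hs
  have hend : ∀ e, (∀ t, h e ≤ h t) → ∀ t, (H ∘ Function.surjInv hs) (g e) ≤
      (H ∘ Function.surjInv hs) t := by
    intro e he t
    obtain ⟨t, rfl⟩ := hs t
    rw [happ, happ]
    exact collapsedHeight_mono hφ (le_antisymm (lowest_le_left h e t)
      (le_lowest_iff.2 fun w _ => he w))
  refine ⟨⟨_, hcont⟩, hg0 ▸ hend 0 h0, hg1 ▸ hend 1 h1, fun s t hst hl => ?_⟩
  obtain ⟨s, rfl⟩ := hs s
  obtain ⟨t, rfl⟩ := hs t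
  simp only [ContinuousMap.coe_mk, happ] at hst hl
  obtain ⟨r, hr, hrl, hmin⟩ := exists_eq_lowest h s t
  have hle : H s ≤ H r := by
    rw [← happ r, ← hl]
    exact lowest_le (h := ⟨_, hcont⟩) (hm.mapsTo_uIcc hr)
  have aux : ∀ u ∈ uIcc s t, H u ≤ H r → Φ (g r) = Φ (g u) := fun u hu hur =>
    dist_eq_zero.1 <| hc.dist_eq_zero_of_collapsedHeight_le hφ (le_antisymm (lowest_le_left h r u)
      (le_lowest_iff.2 fun w hw => hmin w (uIcc_subset_uIcc hr hu hw))) hur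
  rw [← aux s left_mem_uIcc hle, aux t right_mem_uIcc (hst ▸ hle)]

theorem Continuous.concatReverse {X : Type*} [TopologicalSpace X] {α β : unitInterval → X}
    (hα : Continuous α) (hβ : Continuous β) (h : α 1 = β 1) : Continuous (ConcatReverse α β) := by
  unfold ConcatReverse
  refine Continuous.if_le (hα.comp (continuous_projIcc.comp (by fun_prop)))
    (hβ.comp (continuous_projIcc.comp (by fun_prop))) continuous_subtype_val continuous_const
    fun t ht => ?_
  rw [ht, projIcc_of_right_le _ (by norm_num), projIcc_of_right_le _ (by norm_num)]
  exact h

section Reparam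

variable {g₁ g₂ : unitInterval → unitInterval}

/-- The reparameterization of `ConcatReverse α β` induced by reparameterizations of `α`
and `β`. -/
def concatReparam (g₁ g₂ : unitInterval → unitInterval) : unitInterval → unitInterval :=
  ConcatReverse (fun t => ⟨(g₁ t : ℝ) / 2, by linarith [(g₁ t).2.1], by linarith [(g₁ t).2.2]⟩)
    (fun t => ⟨1 - (g₂ t : ℝ) / 2, by linarith [(g₂ t).2.2], by linarith [(g₂ t).2.1]⟩)

theorem coe_concatReparam_of_le {t : unitInterval} (ht : (t : ℝ) ≤ 1 / 2) :
    (concatReparam g₁ g₂ t : ℝ) = g₁ (projIcc (0 : ℝ) 1 zero_le_one (2 * (t : ℝ))) / 2 := by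
  rw [concatReparam, ConcatReverse, if_pos ht]

theorem coe_concatReparam_of_lt {t : unitInterval} (ht : 1 / 2 < (t : ℝ)) :
    (concatReparam g₁ g₂ t : ℝ) =
      1 - g₂ (projIcc (0 : ℝ) 1 zero_le_one (2 - 2 * (t : ℝ))) / 2 := by
  rw [concatReparam, ConcatReverse, if_neg ht.not_ge]

theorem continuous_concatReparam (hg₁ : Continuous g₁) (hg₂ : Continuous g₂) (h₁ : g₁ 1 = 1)
    (h₂ : g₂ 1 = 1) : Continuous (concatReparam g₁ g₂) :=
  Continuous.concatReverse (by fun_prop) (by fun_prop)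
    (Subtype.ext (by simp only [h₁, h₂, Icc.coe_one]; norm_num))

theorem monotone_concatReparam (hm₁ : Monotone g₁) (hm₂ : Monotone g₂) :
    Monotone (concatReparam g₁ g₂) := by
  intro s t hst
  have hst' : (s : ℝ) ≤ t := hst
  rw [← Subtype.coe_le_coe]
  rcases le_or_gt (t : ℝ) (1 / 2) with ht | ht
  · rw [coe_concatReparam_of_le ht, coe_concatReparam_of_le (hst'.trans ht)]
    have := Subtype.coe_le_coe.2
      (hm₁ (monotone_projIcc zero_le_one (by linarith : 2 * (s : ℝ) ≤ 2 * t)))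
    linarith
  rw [coe_concatReparam_of_lt ht]
  rcases le_or_gt (s : ℝ) (1 / 2) with hs | hs
  · rw [coe_concatReparam_of_le hs]
    linarith [(g₁ (projIcc (0 : ℝ) 1 zero_le_one (2 * (s : ℝ)))).2.2,
      (g₂ (projIcc (0 : ℝ) 1 zero_le_one (2 - 2 * (t : ℝ)))).2.2]
  · rw [coe_concatReparam_of_lt hs]
    have := Subtype.coe_le_coe.2
      (hm₂ (monotone_projIcc zero_le_one (by linarith : 2 - 2 * (t : ℝ) ≤ 2 - 2 * s)))
    linarith

theorem concatReparam_zero (h₁ : g₁ 0 = 0) : concatReparam g₁ g₂ 0 = 0 := by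
  ext
  rw [coe_concatReparam_of_le (by simp), Icc.coe_zero, mul_zero, projIcc_left]
  exact (congrArg (fun u : unitInterval => (u : ℝ) / 2) h₁).trans (by simp)

theorem concatReparam_one (h₂ : g₂ 0 = 0) : concatReparam g₁ g₂ 1 = 1 := by
  ext
  rw [coe_concatReparam_of_lt (by norm_num), Icc.coe_one, mul_one, sub_self, projIcc_left]
  exact (congrArg (fun u : unitInterval => 1 - (u : ℝ) / 2) h₂).trans (by simp)

theorem surjective_concatReparam (hg₁ : Continuous g₁) (hg₂ : Continuous g₂)
    (h₁₀ : g₁ 0 = 0) (h₁₁ : g₁ 1 = 1) (h₂₀ : g₂ 0 = 0) (h₂₁ : g₂ 1 = 1) :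
    Function.Surjective (concatReparam g₁ g₂) := fun _ =>
  mem_range_of_exists_le_of_exists_ge (continuous_concatReparam hg₁ hg₂ h₁₁ h₂₁)
    ⟨0, (concatReparam_zero h₁₀).trans_le unitInterval.nonneg'⟩
    ⟨1, unitInterval.le_one'.trans_eq (concatReparam_one h₂₀).symm⟩

theorem concatReverse_comp_concatReparam {X : Type*} {α β : unitInterval → X} (h : α 1 = β 1) :
    ConcatReverse α β ∘ concatReparam g₁ g₂ = ConcatReverse (α ∘ g₁) (β ∘ g₂) := by
  funext t
  rw [Function.comp_apply]
  rcases le_or_gt (t : ℝ) (1 / 2) with ht | ht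
  · have hle := (g₁ (projIcc (0 : ℝ) 1 zero_le_one (2 * (t : ℝ)))).2.2
    simp only [ConcatReverse, coe_concatReparam_of_le ht, if_pos ht]
    rw [if_pos (by linarith), mul_div_cancel₀ _ two_ne_zero, projIcc_val, Function.comp_apply]
  · have hle := (g₂ (projIcc (0 : ℝ) 1 zero_le_one (2 - 2 * (t : ℝ)))).2.2
    simp only [ConcatReverse, coe_concatReparam_of_lt ht, if_neg ht.not_ge, Function.comp_apply]
    generalize g₂ (projIcc (0 : ℝ) 1 zero_le_one (2 - 2 * (t : ℝ))) = u at hle ⊢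
    split_ifs with hu
    · have hu1 : u = 1 := Subtype.ext (le_antisymm hle (by rw [Icc.coe_one]; linarith))
      rw [projIcc_of_right_le _ (by linarith), hu1]
      exact h
    · rw [show 2 - 2 * (1 - (u : ℝ) / 2) = u by ring, projIcc_val]

end Reparam

end

/-- If reparameterizations of `α` and `β` by nondecreasing continuous surjections are
ℝ-tree homotopic, then so are `α` and `β`. -/
theorem rTreeHomotopic_of_reparam {X : Type*} [TopologicalSpace X] [T2Space X]
    (α β : unitInterval → X) (hα : Continuous α) (hβ : Continuous β)
    (g₁ g₂ : unitInterval → unitInterval)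
    (hg₁ : Continuous g₁) (hg₂ : Continuous g₂)
    (hm₁ : Monotone g₁) (hm₂ : Monotone g₂)
    (hs₁ : Function.Surjective g₁) (hs₂ : Function.Surjective g₂)
    (h : RTreeHomotopic (α ∘ g₁) (β ∘ g₂)) :
    RTreeHomotopic α β := by
  have hz₁ := hm₁.unitInterval_map_zero hs₁
  have hz₂ := hm₂.unitInterval_map_zero hs₂
  have ho₁ := hm₁.unitInterval_map_one hs₁
  have ho₂ := hm₂.unitInterval_map_one hs₂
  obtain ⟨h0, h1, hfac⟩ := h
  simp only [Function.comp_apply, hz₁, hz₂, ho₁, ho₂] at h0 h1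
  have hγ := hα.concatReverse hβ h1
  have hg := continuous_concatReparam hg₁ hg₂ ho₁ ho₂
  rw [← concatReverse_comp_concatReparam h1, exists_rTree_factorization_iff (hγ.comp hg)] at hfac
  obtain ⟨c, hc0, hc1, hc⟩ := hfac
  obtain ⟨Φ, hΦ, hfib⟩ := exists_continuous_real_sequence_eq_iff hγ
  let := TopologicalSpace.metrizableSpaceMetric (ℕ → ℝ)
  obtain ⟨c', hc0', hc1', hc'⟩ := IsContourOf.exists_of_comp hΦ hg
    (monotone_concatReparam hm₁ hm₂) (surjective_concatReparam hg₁ hg₂ hz₁ ho₁ hz₂ ho₂)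
    (fun s t hs ht => (hfib _ _).2 (hc s t hs ht)) hc0 hc1
  exact ⟨h0, h1, (exists_rTree_factorization_iff hγ).2
    ⟨c', hc0', hc1', fun s t hs ht => (hfib s t).1 (hc' s t hs ht)⟩⟩
end

section
/- Let X be a Hausdorff topological space and α₁, α₂, β₁, β₂ : [0,1] → X be paths such that α₁ ≃ᵣ α₂, α₁ is Fréchet equivalent to β₁, and α₂ is Fréchet equivalent to β₂. Then β₁ ≃ᵣ β₂. -/
open Set Filter Topology

/-- `s` lies below `t` for the height function `g`: going from `s` to `t`, the height never drops
under `g s`. In the tree coded by `g`, this means that `s` is on the arc from the root to `t`. -/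
def LiesBelow (g : unitInterval → ℝ) (s t : unitInterval) : Prop :=
  ∀ u ∈ uIcc s t, g s ≤ g u

namespace LiesBelow

variable {g : unitInterval → ℝ} {m r s t : unitInterval}

lemma refl (g : unitInterval → ℝ) (s : unitInterval) : LiesBelow g s s := by
  intro u hu
  rw [uIcc_self, mem_singleton_iff] at hu
  rw [hu]

lemma le (h : LiesBelow g s t) : g s ≤ g t := h t right_mem_uIcc

lemma trans (h : LiesBelow g r s) (h' : LiesBelow g s t) : LiesBelow g r t := by
  intro u hu
  rcases uIcc_subset_uIcc_union_uIcc (b := s) hu with hu | hu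
  · exact h u hu
  · exact h.le.trans (h' u hu)

lemma of_le (h : LiesBelow g r t) (h' : LiesBelow g s t) (hrs : g r ≤ g s) :
    LiesBelow g r s := by
  intro u hu
  rcases uIcc_subset_uIcc_union_uIcc (b := t) hu with hu | hu
  · exact h u hu
  · exact hrs.trans (h' u (uIcc_comm t s ▸ hu))

end LiesBelow

lemma exists_liesBelow_both {g : unitInterval → ℝ} (hg : Continuous g) (s t : unitInterval) :
    ∃ m ∈ uIcc s t, (∀ u ∈ uIcc s t, g m ≤ g u) ∧ LiesBelow g m s ∧ LiesBelow g m t := by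
  obtain ⟨m, hm, hmin⟩ := isCompact_uIcc.exists_isMinOn ⟨s, left_mem_uIcc⟩ hg.continuousOn
  refine ⟨m, hm, fun u hu => hmin hu, fun u hu => hmin ?_, fun u hu => hmin ?_⟩
  · exact uIcc_subset_uIcc hm left_mem_uIcc hu
  · exact uIcc_subset_uIcc hm right_mem_uIcc hu

lemma dist_le_of_mem_uIcc {s t x y : unitInterval} (hx : x ∈ uIcc s t) (hy : y ∈ uIcc s t) :
    dist x y ≤ dist s t := by
  rw [mem_uIcc] at hx hy
  refine Real.dist_le_of_mem_uIcc (x := (x : ℝ)) ?_ ?_ <;> rw [mem_uIcc] <;> assumption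

lemma eq_of_mem_uIcc_of_dist_le {w s u : unitInterval} (hu : u ∈ uIcc w s)
    (h : dist w s ≤ dist u s) : u = w := by
  rw [Subtype.dist_eq, Subtype.dist_eq, Real.dist_eq, Real.dist_eq] at h
  rw [mem_uIcc] at hu
  apply Subtype.ext
  simp only [← Subtype.coe_le_coe] at hu
  rcases hu with hu | hu
  · rw [abs_of_nonpos (by linarith), abs_of_nonpos (by linarith)] at h
    linarith
  · rw [abs_of_nonneg (by linarith), abs_of_nonneg (by linarith)] at h
    linarith

lemma exists_liesBelow_of_height {g : unitInterval → ℝ} (hg : Continuous g) {m s : unitInterval}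
    {r : ℝ} (hm : g m ≤ r) (hs : r ≤ g s) : ∃ w ∈ uIcc m s, LiesBelow g w s ∧ g w = r := by
  have ivt : ∀ a b, g a ≤ r → r ≤ g b → ∃ x ∈ uIcc a b, g x = r := fun a b ha hb =>
    intermediate_value_uIcc hg.continuousOn (mem_uIcc_of_le ha hb)
  have hK : IsCompact (uIcc m s ∩ g ⁻¹' {r}) :=
    isCompact_uIcc.inter_right (isClosed_singleton.preimage hg)
  obtain ⟨w, ⟨hw, hwr⟩, hmin⟩ := hK.exists_isMinOn (ivt m s hm hs)
    (f := fun w => dist w s) (by fun_prop)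
  refine ⟨w, hw, fun u hu => ?_, hwr⟩
  by_contra! hlt
  obtain ⟨x, hx, hxr⟩ := ivt u s (hlt.le.trans_eq hwr) hs
  have hum := uIcc_subset_uIcc hw right_mem_uIcc hu
  have h1 : dist w s ≤ dist x s := hmin ⟨uIcc_subset_uIcc hum right_mem_uIcc hx, hxr⟩
  have h2 : dist x s ≤ dist u s := dist_le_of_mem_uIcc hx right_mem_uIcc
  rw [eq_of_mem_uIcc_of_dist_le hu (h1.trans h2)] at hlt
  exact lt_irrefl _ hlt

/-- The height function `g` codes the loop `γ`: it is minimal at both endpoints, and `γ` descends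
to the tree obtained from `[0,1]` by identifying points that lie below each other. -/
structure CodesLoop {X : Type*} (g : unitInterval → ℝ) (γ : unitInterval → X) : Prop where
  continuous : Continuous g
  zero_le : ∀ t, g 0 ≤ g t
  one_eq : g 1 = g 0
  eq_of_liesBelow : ∀ s t, LiesBelow g s t → LiesBelow g t s → γ s = γ t

lemma CodesLoop.liesBelow_zero {X : Type*} {g : unitInterval → ℝ} {γ : unitInterval → X}
    (h : CodesLoop g γ) (t : unitInterval) : LiesBelow g 0 t :=
  fun u _ => h.zero_le u

lemma CodesLoop.exists_mem_uIcc_eq {X : Type*} {g : unitInterval → ℝ} {γ : unitInterval → X}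
    (h : CodesLoop g γ) {m w t : unitInterval} (hmw : LiesBelow g m w) (hwt : LiesBelow g w t) :
    ∃ x ∈ uIcc m t, γ x = γ w := by
  obtain ⟨x, hx, hxt, hxw⟩ := exists_liesBelow_of_height h.continuous hmw.le hwt.le
  exact ⟨x, hx, h.eq_of_liesBelow x w (hxt.of_le hwt hxw.le) (hwt.of_le hxt hxw.ge)⟩

section ChainSum

variable {M : Type*} [PseudoMetricSpace M] {g : unitInterval → ℝ} {γ : unitInterval → M}
  {ε : ℝ}

/-- `ChainSum g γ ε t c`: there is a chain of points, each lying below the next and the last one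
being `t`, along which the jumps of `γ`, each truncated by `ε`, add up to `c`. -/
inductive ChainSum (g : unitInterval → ℝ) (γ : unitInterval → M) (ε : ℝ) :
    unitInterval → ℝ → Prop
  | zero (t : unitInterval) : ChainSum g γ ε t 0
  | step {s t : unitInterval} {c : ℝ} (hc : ChainSum g γ ε s c) (hst : LiesBelow g s t) :
      ChainSum g γ ε t (c + max (dist (γ s) (γ t) - ε) 0)

lemma ChainSum.exists_le_add {m t : unitInterval} {c η : ℝ} (hη : 0 ≤ η) (hηε : η ≤ ε)
    (hc : ChainSum g γ ε t c) (hmt : LiesBelow g m t)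
    (H : ∀ w w', LiesBelow g m w → LiesBelow g w t → LiesBelow g m w' → LiesBelow g w' t →
      dist (γ w) (γ w') ≤ η) :
    ∃ c', ChainSum g γ ε m c' ∧ c ≤ c' + η := by
  induction hc with
  | zero t => exact ⟨0, .zero m, by linarith⟩
  | @step s t c hc hst ih =>
    rcases le_total (g s) (g m) with hsm | hms
    · refine ⟨_, hc.step (hst.of_le hmt hsm), ?_⟩
      have h1 := H m t (.refl g m) hmt hmt (.refl g t)
      have h2 := dist_triangle (γ s) (γ m) (γ t)
      have h3 : max (dist (γ s) (γ t) - ε) 0 ≤ max (dist (γ s) (γ m) - ε) 0 + η := by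
        refine max_le ?_ ?_
        · linarith [le_max_left (dist (γ s) (γ m) - ε) 0]
        · linarith [le_max_right (dist (γ s) (γ m) - ε) 0]
      linarith
    · have hms := hmt.of_le hst hms
      obtain ⟨c', hc', hle⟩ := ih hms fun w w' h1 h2 h3 h4 =>
        H w w' h1 (h2.trans hst) h3 (h4.trans hst)
      refine ⟨c', hc', ?_⟩
      have h1 := H s t hms hst hmt (.refl g t)
      rw [max_eq_right (by linarith)]
      linarith

lemma ChainSum.exists_ge {m t : unitInterval} {c : ℝ} (hc : ChainSum g γ ε m c)
    (hmt : LiesBelow g m t) : ∃ c', ChainSum g γ ε t c' ∧ c ≤ c' :=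
  ⟨_, hc.step hmt, by linarith [le_max_right (dist (γ m) (γ t) - ε) 0]⟩

lemma CodesLoop.chainSum_eq_zero (h : CodesLoop g γ) (hε : 0 ≤ ε) {t : unitInterval} {c : ℝ}
    (hc : ChainSum g γ ε t c) (ht : LiesBelow g t 0) : c = 0 := by
  induction hc with
  | zero t => rfl
  | @step s t c hc hst ih =>
    rw [ih (hst.trans ht), h.eq_of_liesBelow s t hst (ht.trans (h.liesBelow_zero s)), dist_self,
      max_eq_right (by linarith), add_zero]

lemma CodesLoop.exists_delta (h : CodesLoop g γ) (hγ : Continuous γ) {η : ℝ} (hη : 0 < η) :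
    ∃ δ > 0, ∀ m t, dist m t < δ →
      ∀ w w', LiesBelow g m w → LiesBelow g w t → LiesBelow g m w' → LiesBelow g w' t →
        dist (γ w) (γ w') ≤ η := by
  obtain ⟨δ, hδ, hu⟩ := Metric.uniformContinuous_iff.1
    (CompactSpace.uniformContinuous_of_continuous hγ) η hη
  refine ⟨δ, hδ, fun m t hmt w w' h1 h2 h3 h4 => ?_⟩
  obtain ⟨x, hx, hxw⟩ := h.exists_mem_uIcc_eq h1 h2
  obtain ⟨y, hy, hyw⟩ := h.exists_mem_uIcc_eq h3 h4
  rw [← hxw, ← hyw]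
  exact (hu ((dist_le_of_mem_uIcc hx hy).trans_lt hmt)).le

lemma CodesLoop.exists_chainSum_near (h : CodesLoop g γ) (hγ : Continuous γ) {η : ℝ} (hη : 0 < η)
    (hηε : η ≤ ε) : ∃ δ > 0, ∀ t t', dist t t' < δ → ∀ c, ChainSum g γ ε t c →
      ∃ c', ChainSum g γ ε t' c' ∧ c ≤ c' + η := by
  obtain ⟨δ, hδ, H⟩ := h.exists_delta hγ hη
  refine ⟨δ, hδ, fun t t' htt' c hc => ?_⟩
  obtain ⟨m, hm, -, hmt, hmt'⟩ := exists_liesBelow_both h.continuous t t'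
  obtain ⟨c', hc', hle⟩ := hc.exists_le_add hη.le hηε hmt
    (H m t ((dist_le_of_mem_uIcc hm left_mem_uIcc).trans_lt htt'))
  obtain ⟨c'', hc'', hle'⟩ := hc'.exists_ge hmt'
  exact ⟨c'', hc'', by linarith⟩

lemma CodesLoop.bddAbove_chainSum (h : CodesLoop g γ) (hγ : Continuous γ) (hε : 0 < ε)
    (t : unitInterval) : BddAbove {c | ChainSum g γ ε t c} := by
  obtain ⟨δ, hδ, H⟩ := h.exists_chainSum_near hγ hε le_rfl
  have key : ∀ x y, dist x y < δ → BddAbove {c | ChainSum g γ ε x c} →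
      BddAbove {c | ChainSum g γ ε y c} := by
    rintro x y hxy ⟨b, hb⟩
    refine ⟨b + ε, fun c hc => ?_⟩
    obtain ⟨c', hc', hle⟩ := H y x (by rwa [dist_comm]) c hc
    linarith [hb hc']
  refine isPreconnected_univ.induction₂' (fun x y => BddAbove {c | ChainSum g γ ε x c} →
    BddAbove {c | ChainSum g γ ε y c}) (fun x _ => ?_) (fun _ _ _ _ _ _ h1 h2 => h2 ∘ h1)
    (mem_univ 0) (mem_univ t) ⟨0, fun c hc => (h.chainSum_eq_zero hε.le hc (.refl g 0)).le⟩
  rw [nhdsWithin_univ]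
  filter_upwards [Metric.ball_mem_nhds x hδ] with y hy
  exact ⟨key x y (by rwa [dist_comm]), key y x hy⟩

/-- The supremum of the truncated jumps of `γ` along chains ending at `t`. -/
noncomputable def truncatedVariation (g : unitInterval → ℝ) (γ : unitInterval → M) (ε : ℝ)
    (t : unitInterval) : ℝ :=
  sSup {c | ChainSum g γ ε t c}

lemma CodesLoop.le_truncatedVariation (h : CodesLoop g γ) (hγ : Continuous γ) (hε : 0 < ε)
    {t : unitInterval} {c : ℝ} (hc : ChainSum g γ ε t c) : c ≤ truncatedVariation g γ ε t :=
  le_csSup (h.bddAbove_chainSum hγ hε t) hc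

lemma truncatedVariation_le {t : unitInterval} {b : ℝ} (hb : ∀ c, ChainSum g γ ε t c → c ≤ b) :
    truncatedVariation g γ ε t ≤ b :=
  csSup_le ⟨0, .zero t⟩ hb

lemma CodesLoop.truncatedVariation_nonneg (h : CodesLoop g γ) (hγ : Continuous γ) (hε : 0 < ε)
    (t : unitInterval) : 0 ≤ truncatedVariation g γ ε t :=
  h.le_truncatedVariation hγ hε (.zero t)

lemma CodesLoop.truncatedVariation_add_le (h : CodesLoop g γ) (hγ : Continuous γ) (hε : 0 < ε)
    {m t : unitInterval} (hmt : LiesBelow g m t) :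
    truncatedVariation g γ ε m + max (dist (γ m) (γ t) - ε) 0 ≤ truncatedVariation g γ ε t := by
  rw [← le_sub_iff_add_le]
  refine truncatedVariation_le fun c hc => ?_
  linarith [h.le_truncatedVariation hγ hε (hc.step hmt)]

lemma CodesLoop.truncatedVariation_mono (h : CodesLoop g γ) (hγ : Continuous γ) (hε : 0 < ε)
    {m t : unitInterval} (hmt : LiesBelow g m t) :
    truncatedVariation g γ ε m ≤ truncatedVariation g γ ε t := by
  linarith [h.truncatedVariation_add_le hγ hε hmt, le_max_right (dist (γ m) (γ t) - ε) 0]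

lemma CodesLoop.truncatedVariation_eq (h : CodesLoop g γ) (hγ : Continuous γ) (hε : 0 < ε)
    {m t : unitInterval} (hmt : LiesBelow g m t) (hc : ∀ u ∈ uIcc m t, γ u = γ m) :
    truncatedVariation g γ ε m = truncatedVariation g γ ε t := by
  refine (h.truncatedVariation_mono hγ hε hmt).antisymm (truncatedVariation_le fun c hct => ?_)
  obtain ⟨c', hc', hle⟩ := hct.exists_le_add le_rfl hε.le hmt fun w w' h1 h2 h3 h4 => by
    obtain ⟨x, hx, hxw⟩ := h.exists_mem_uIcc_eq h1 h2
    obtain ⟨y, hy, hyw⟩ := h.exists_mem_uIcc_eq h3 h4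
    rw [← hxw, ← hyw, hc x hx, hc y hy, dist_self]
  linarith [h.le_truncatedVariation hγ hε hc']

lemma CodesLoop.continuous_truncatedVariation (h : CodesLoop g γ) (hγ : Continuous γ)
    (hε : 0 < ε) : Continuous (truncatedVariation g γ ε) := by
  rw [Metric.continuous_iff]
  intro t η hη
  obtain ⟨δ, hδ, H⟩ := h.exists_chainSum_near hγ (lt_min (half_pos hη) hε) (min_le_right _ _)
  have key : ∀ x y, dist x y < δ →
      truncatedVariation g γ ε x ≤ truncatedVariation g γ ε y + η / 2 := fun x y hxy =>
    truncatedVariation_le fun c hc => by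
      obtain ⟨c', hc', hle⟩ := H x y hxy c hc
      linarith [h.le_truncatedVariation hγ hε hc', min_le_left (η / 2) ε]
  refine ⟨δ, hδ, fun s hs => ?_⟩
  rw [Real.dist_eq, abs_lt]
  have h1 := key s t hs
  have h2 := key t s (by rwa [dist_comm])
  constructor <;> linarith

lemma CodesLoop.exists_codesLoop_eq_on_constant (h : CodesLoop g γ) (hγ : Continuous γ)
    (hM : ∀ x y : M, dist x y = 0 → x = y) :
    ∃ g' : unitInterval → ℝ, CodesLoop g' γ ∧
      ∀ s t, (∀ u ∈ uIcc s t, γ u = γ s) → g' s = g' t := by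
  set ε : ℕ → ℝ := fun k => 1 / ((k : ℝ) + 1)
  have hε : ∀ k, 0 < ε k := fun k => Nat.one_div_pos_of_nat
  set F : ℕ → unitInterval → ℝ := fun k t =>
    (1 / 2 : ℝ) ^ k * (1 - (1 + truncatedVariation g γ (ε k) t)⁻¹)
  have hV := fun k t => h.truncatedVariation_nonneg hγ (hε k) t
  have hFcont : ∀ k, Continuous (F k) := fun k => continuous_const.mul
    (continuous_const.sub ((continuous_const.add
      (h.continuous_truncatedVariation hγ (hε k))).inv₀
        fun t (ht : 1 + truncatedVariation g γ (ε k) t = 0) => by linarith [hV k t]))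
  have hbound : ∀ k t, ‖F k t‖ ≤ (1 / 2 : ℝ) ^ k := by
    intro k t
    have h1 : 0 < (1 + truncatedVariation g γ (ε k) t)⁻¹ := by have := hV k t; positivity
    have h2 : (1 + truncatedVariation g γ (ε k) t)⁻¹ ≤ 1 :=
      inv_le_one_of_one_le₀ (by linarith [hV k t])
    rw [norm_mul, Real.norm_eq_abs, Real.norm_eq_abs, abs_of_nonneg (by positivity)]
    refine mul_le_of_le_one_right (by positivity) (abs_le.2 ⟨by linarith, by linarith⟩)
  have hsum : ∀ t, Summable fun k => F k t := fun t =>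
    summable_geometric_two.of_norm_bounded (fun k => hbound k t)
  have hmono : ∀ m t, LiesBelow g m t → ∀ k, F k m ≤ F k t := by
    intro m t hmt k
    have h1 := h.truncatedVariation_mono hγ (hε k) hmt
    have h2 := hV k m
    simp only [F]
    gcongr
  have hlt : ∀ m t, LiesBelow g m t → ∑' k, F k t ≤ ∑' k, F k m → γ m = γ t := by
    intro m t hmt hle
    by_contra hne
    have hd : 0 < dist (γ m) (γ t) := dist_nonneg.lt_of_ne fun h0 => hne (hM _ _ h0.symm)
    obtain ⟨k, hk⟩ := exists_nat_one_div_lt hd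
    refine hle.not_gt (Summable.tsum_lt_tsum (hmono m t hmt) (i := k) ?_ (hsum m) (hsum t))
    have h1 := h.truncatedVariation_add_le hγ (hε k) hmt
    have h2 := hV k m
    have h3 : truncatedVariation g γ (ε k) m < truncatedVariation g γ (ε k) t := by
      have : dist (γ m) (γ t) - ε k > 0 := sub_pos.2 hk
      linarith [le_max_left (dist (γ m) (γ t) - ε k) 0]
    simp only [F]
    gcongr
  have hmono' : ∀ m t, LiesBelow g m t → ∑' k, F k m ≤ ∑' k, F k t := fun m t hmt =>
    (hsum m).tsum_le_tsum (hmono m t hmt) (hsum t)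
  refine ⟨fun t => ∑' k, F k t, ⟨continuous_tsum hFcont summable_geometric_two hbound,
    fun t => hmono' 0 t (h.liesBelow_zero t), (hmono' 1 0 fun u _ => ?_).antisymm
      (hmono' 0 1 (h.liesBelow_zero 1)), fun s t hst hts => ?_⟩, fun s t hst => ?_⟩
  · exact h.one_eq.trans_le (h.zero_le u)
  · obtain ⟨m, hm, -, hms, hmt⟩ := exists_liesBelow_both h.continuous s t
    rw [← hlt m s hms (hst m hm), ← hlt m t hmt (hts m (uIcc_comm s t ▸ hm))]
  · obtain ⟨m, hm, -, hms, hmt⟩ := exists_liesBelow_both h.continuous s t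
    have key : ∀ x ∈ uIcc s t, LiesBelow g m x → ∀ k, F k m = F k x := fun x hx hmx k => by
      simp only [F]
      rw [h.truncatedVariation_eq hγ (hε k) hmx fun u hu =>
        (hst u (uIcc_subset_uIcc hm hx hu)).trans (hst m hm).symm]
    exact tsum_congr fun k => (key s left_mem_uIcc hms k).symm.trans (key t right_mem_uIcc hmt k)

end ChainSum

lemma Monotone.map_bot_of_surjective {A B : Type*} [PartialOrder A] [OrderBot A] [PartialOrder B]
    [OrderBot B] {f : A → B} (hf : Monotone f) (hs : Function.Surjective f) : f ⊥ = ⊥ := by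
  obtain ⟨a, ha⟩ := hs ⊥
  exact le_bot_iff.1 (ha ▸ hf bot_le)

lemma Monotone.map_top_of_surjective {A B : Type*} [PartialOrder A] [OrderTop A] [PartialOrder B]
    [OrderTop B] {f : A → B} (hf : Monotone f) (hs : Function.Surjective f) : f ⊤ = ⊤ := by
  obtain ⟨a, ha⟩ := hs ⊤
  exact top_le_iff.1 (ha ▸ hf le_top)

lemma metrizableSpace_of_continuous_surjective {A B : Type*} [TopologicalSpace A] [CompactSpace A]
    [SecondCountableTopology C(A, ℝ)] [TopologicalSpace B] [T2Space B] {p : A → B}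
    (hp : Continuous p) (hsurj : Function.Surjective p) : TopologicalSpace.MetrizableSpace B := by
  have : CompactSpace B := ⟨hsurj.range_eq ▸ isCompact_range hp⟩
  have hiso : Isometry fun φ : C(B, ℝ) => φ.comp ⟨p, hp⟩ := by
    refine Isometry.of_dist_eq fun φ ψ => le_antisymm ?_ ?_
    · rw [ContinuousMap.dist_le dist_nonneg]
      exact fun x => ContinuousMap.dist_apply_le_dist (p x)
    · rw [ContinuousMap.dist_le dist_nonneg]
      intro y
      obtain ⟨x, rfl⟩ := hsurj y
      exact ContinuousMap.dist_apply_le_dist (f := φ.comp ⟨p, hp⟩) (g := ψ.comp ⟨p, hp⟩) x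
  have : SecondCountableTopology C(B, ℝ) := hiso.isEmbedding.secondCountableTopology
  let φ := TopologicalSpace.denseSeq C(B, ℝ)
  have hcont : Continuous fun (y : B) (k : ℕ) => φ k y :=
    continuous_pi fun k => (φ k).continuous
  refine (hcont.isClosedEmbedding fun x y hxy => ?_).isEmbedding.metrizableSpace
  by_contra hne
  obtain ⟨f, hf0, hf1, -⟩ := exists_continuous_zero_one_of_isClosed
    (isClosed_singleton (x := x)) (isClosed_singleton (x := y)) (by simpa using hne)
  have hopen : IsOpen {ψ : C(B, ℝ) | ψ x ≠ ψ y} :=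
    isOpen_ne_fun (continuous_eval_const x) (continuous_eval_const y)
  obtain ⟨k, hk⟩ := (TopologicalSpace.denseRange_denseSeq C(B, ℝ)).exists_mem_open hopen
    ⟨f, by simp [hf0 rfl, hf1 rfl]⟩
  exact hk (congrFun hxy k)

/-- A coding height function can be made constant on the intervals where the loop is constant. -/
lemma CodesLoop.exists_eq_on_constant {X : Type*} [TopologicalSpace X] [T2Space X]
    {g : unitInterval → ℝ} {γ : unitInterval → X} (h : CodesLoop g γ) (hγ : Continuous γ) :
    ∃ g' : unitInterval → ℝ, CodesLoop g' γ ∧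
      ∀ s t, (∀ u ∈ uIcc s t, γ u = γ s) → g' s = g' t := by
  have : TopologicalSpace.MetrizableSpace (range γ) := metrizableSpace_of_continuous_surjective
    (hγ.subtype_mk mem_range_self) fun ⟨_, x, hx⟩ => ⟨x, Subtype.ext hx⟩
  let := TopologicalSpace.metrizableSpaceMetric (range γ)
  have h' : CodesLoop g fun t => (⟨γ t, mem_range_self t⟩ : range γ) :=
    ⟨h.continuous, h.zero_le, h.one_eq, fun s t h1 h2 => Subtype.ext (h.eq_of_liesBelow s t h1 h2)⟩
  obtain ⟨g', hg', hconst⟩ := h'.exists_codesLoop_eq_on_constant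
    (hγ.subtype_mk mem_range_self) fun _ _ => eq_of_dist_eq_zero
  exact ⟨g', ⟨hg'.continuous, hg'.zero_le, hg'.one_eq, fun s t h1 h2 =>
    congrArg Subtype.val (hg'.eq_of_liesBelow s t h1 h2)⟩,
    fun s t hst => hconst s t fun u hu => Subtype.ext (hst u hu)⟩

/-- A coding of a monotone reparameterization of a loop yields a coding of the loop. -/
lemma CodesLoop.exists_of_comp {X : Type*} [TopologicalSpace X] [T2Space X]
    {g : unitInterval → ℝ} {γ : unitInterval → X} {b : unitInterval → unitInterval}
    (h : CodesLoop g (γ ∘ b)) (hγ : Continuous γ) (hb : Continuous b) (hmono : Monotone b)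
    (hsurj : Function.Surjective b) : ∃ g' : unitInterval → ℝ, CodesLoop g' γ := by
  obtain ⟨k, hk, hconst⟩ := h.exists_eq_on_constant (hγ.comp hb)
  have hfiber : ∀ s t, b s = b t → k s = k t := fun s t hst => hconst s t fun u hu => by
    have hu' := hmono.mapsTo_uIcc hu
    rw [← hst, uIcc_self, mem_singleton_iff] at hu'
    simp [hu']
  set c := Function.surjInv hsurj
  have hc : ∀ y, b (c y) = y := Function.surjInv_eq hsurj
  have hkc : (k ∘ c) ∘ b = k := funext fun t => hfiber _ _ (hc (b t))
  have hb0 : b 0 = 0 := hmono.map_bot_of_surjective hsurj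
  have hb1 : b 1 = 1 := hmono.map_top_of_surjective hsurj
  have hbelow : ∀ x y, LiesBelow (k ∘ c) x y → LiesBelow k (c x) (c y) := fun x y hxy u hu => by
    have hu' := hmono.mapsTo_uIcc hu
    rw [hc, hc] at hu'
    exact (hxy _ hu').trans_eq (congrFun hkc u)
  refine ⟨k ∘ c, ?_, fun t => ?_, ?_, fun x y hxy hyx => ?_⟩
  · rw [(hb.isClosedMap.isQuotientMap hb hsurj).continuous_iff, hkc]
    exact hk.continuous
  · rw [← hb0]
    exact (congrFun hkc 0).trans_le (hk.zero_le _)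
  · rw [← hb0, ← hb1]
    exact ((congrFun hkc 1).trans hk.one_eq).trans (congrFun hkc 0).symm
  · simpa [hc] using hk.eq_of_liesBelow _ _ (hbelow x y hxy) (hbelow y x hyx)

lemma continuousOn_of_dist_eq {T : Type*} [MetricSpace T] {γ : ℝ → T} {L : ℝ}
    (h : ∀ s ∈ Icc 0 L, ∀ t ∈ Icc 0 L, dist (γ s) (γ t) = |s - t|) :
    ContinuousOn γ (Icc 0 L) := by
  refine (LipschitzOnWith.of_dist_le_mul (K := 1) fun s hs t ht => ?_).continuousOn
  simp [h s hs t ht, Real.dist_eq]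

/-- Two geodesics that only meet at the end of the first and the start of the second concatenate
to an arc. -/
lemma exists_arc_of_geodesics {T : Type*} [MetricSpace T] {γ₁ γ₂ : ℝ → T} {L₁ L₂ : ℝ}
    (hL₁ : 0 ≤ L₁) (hL₂ : 0 ≤ L₂) (hL : 0 < L₁ + L₂)
    (h₁ : ∀ s ∈ Icc 0 L₁, ∀ t ∈ Icc 0 L₁, dist (γ₁ s) (γ₁ t) = |s - t|)
    (h₂ : ∀ s ∈ Icc 0 L₂, ∀ t ∈ Icc 0 L₂, dist (γ₂ s) (γ₂ t) = |s - t|)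
    (h₁₂ : γ₁ L₁ = γ₂ 0)
    (hdisj : ∀ u ∈ Icc 0 L₁, ∀ v ∈ Icc 0 L₂, γ₁ u = γ₂ v → u = L₁) :
    ∃ p : unitInterval → T, Continuous p ∧ Function.Injective p ∧ p 0 = γ₁ 0 ∧ p 1 = γ₂ L₂ ∧
      (∀ t, p t ∈ γ₁ '' Icc 0 L₁ ∪ γ₂ '' Icc 0 L₂) ∧ γ₁ L₁ ∈ range p := by
  have inj₁ : ∀ s ∈ Icc 0 L₁, ∀ t ∈ Icc 0 L₁, γ₁ s = γ₁ t → s = t := fun s hs t ht hst => by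
    rw [← sub_eq_zero, ← abs_eq_zero, ← h₁ s hs t ht, hst, dist_self]
  have inj₂ : ∀ s ∈ Icc 0 L₂, ∀ t ∈ Icc 0 L₂, γ₂ s = γ₂ t → s = t := fun s hs t ht hst => by
    rw [← sub_eq_zero, ← abs_eq_zero, ← h₂ s hs t ht, hst, dist_self]
  set c : ℝ → T := fun u => if u ≤ L₁ then IccExtend hL₁ (domRestrict (Icc 0 L₁) γ₁) u
    else IccExtend hL₂ (domRestrict (Icc 0 L₂) γ₂) (u - L₁) with hc
  have hcont : Continuous c := by
    refine Continuous.if_le (continuousOn_of_dist_eq h₁).domRestrict.Icc_extend'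
      ((continuousOn_of_dist_eq h₂).domRestrict.Icc_extend'.comp (continuous_sub_right L₁))
      continuous_id continuous_const fun u hu => ?_
    subst hu
    simpa using h₁₂
  have hc₁ : ∀ u ∈ Icc 0 L₁, c u = γ₁ u := fun u hu => by
    simp only [hc, if_pos hu.2]
    rw [IccExtend_of_mem _ _ hu, domRestrict_apply]
  have hc₂ : ∀ u ∈ Icc 0 (L₁ + L₂), L₁ < u → c u = γ₂ (u - L₁) := fun u hu h => by
    simp only [hc, if_neg h.not_ge]
    rw [IccExtend_of_mem _ _ ⟨by linarith, by linarith [hu.2]⟩, domRestrict_apply]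
  have hinj : InjOn c (Icc 0 (L₁ + L₂)) := by
    intro u hu v hv huv
    rcases le_or_gt u L₁ with hu' | hu' <;> rcases le_or_gt v L₁ with hv' | hv'
    · rw [hc₁ u ⟨hu.1, hu'⟩, hc₁ v ⟨hv.1, hv'⟩] at huv
      exact inj₁ u ⟨hu.1, hu'⟩ v ⟨hv.1, hv'⟩ huv
    · have hv2 : v - L₁ ∈ Icc 0 L₂ := ⟨by linarith, by linarith [hv.2]⟩
      rw [hc₁ u ⟨hu.1, hu'⟩, hc₂ v hv hv'] at huv
      have := hdisj u ⟨hu.1, hu'⟩ _ hv2 huv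
      rw [this, h₁₂] at huv
      linarith [inj₂ 0 ⟨le_rfl, hL₂⟩ _ hv2 huv]
    · have hu2 : u - L₁ ∈ Icc 0 L₂ := ⟨by linarith, by linarith [hu.2]⟩
      rw [hc₁ v ⟨hv.1, hv'⟩, hc₂ u hu hu'] at huv
      have := hdisj v ⟨hv.1, hv'⟩ _ hu2 huv.symm
      rw [this, h₁₂] at huv
      linarith [inj₂ 0 ⟨le_rfl, hL₂⟩ _ hu2 huv.symm]
    · rw [hc₂ u hu hu', hc₂ v hv hv'] at huv
      linarith [inj₂ _ ⟨by linarith, by linarith [hu.2]⟩ _ ⟨by linarith, by linarith [hv.2]⟩ huv]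
  have hmem : ∀ t : unitInterval, (t : ℝ) * (L₁ + L₂) ∈ Icc 0 (L₁ + L₂) := fun t =>
    ⟨mul_nonneg t.2.1 hL.le, mul_le_of_le_one_left hL.le t.2.2⟩
  refine ⟨fun t => c (t * (L₁ + L₂)), by fun_prop, fun s t hst => ?_, ?_, ?_, fun t => ?_, ?_⟩
  · exact Subtype.ext (mul_right_cancel₀ hL.ne' (hinj (hmem s) (hmem t) hst))
  · simp [hc₁ 0 ⟨le_rfl, hL₁⟩]
  · rcases hL₂.eq_or_lt with rfl | h
    · simp [hc₁ L₁ ⟨hL₁, le_rfl⟩, h₁₂]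
    · simp [hc₂ (L₁ + L₂) ⟨hL.le, le_rfl⟩ (by linarith)]
  · rcases le_or_gt ((t : ℝ) * (L₁ + L₂)) L₁ with h | h
    · exact .inl ⟨_, ⟨(hmem t).1, h⟩, (hc₁ _ ⟨(hmem t).1, h⟩).symm⟩
    · exact .inr ⟨_, ⟨by linarith, by linarith [(hmem t).2]⟩, (hc₂ _ (hmem t) h).symm⟩
  · refine ⟨⟨L₁ / (L₁ + L₂), by positivity, (div_le_one hL).2 (by linarith)⟩, ?_⟩
    simp [div_mul_cancel₀ _ hL.ne', hc₁ L₁ ⟨hL₁, le_rfl⟩]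

/-- A geodesic triangle in an `ℝ`-tree is a tripod: each side is covered by the other two. -/
lemma IsRTree.between_or_between {T : Type} [MetricSpace T] (hT : IsRTree T) {a b c z : T}
    (hz : dist a z + dist z c = dist a c) :
    dist a z + dist z b = dist a b ∨ dist b z + dist z c = dist b c := by
  rcases eq_or_ne a c with rfl | hac
  · have : a = z := dist_eq_zero.1 (by
      linarith [dist_self a, dist_comm a z, dist_nonneg (x := a) (y := z)])
    simp [this]
  obtain ⟨γ₁, h₁0, h₁1, h₁⟩ := hT.geodesic a b
  obtain ⟨γ₂, h₂0, h₂1, h₂⟩ := hT.geodesic b c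
  obtain ⟨γ₃, h₃0, h₃1, h₃⟩ := hT.geodesic a z
  obtain ⟨γ₄, h₄0, h₄1, h₄⟩ := hT.geodesic z c
  have hac' := dist_pos.2 hac
  -- the geodesic from `a` to `c` through `z`
  obtain ⟨p, hp, hpinj, hp0, hp1, -, hpz⟩ := exists_arc_of_geodesics dist_nonneg dist_nonneg
    (hz ▸ hac') h₃ h₄ (h₃1.trans h₄0.symm) fun u hu v hv huv => by
      have h1 := h₃ 0 ⟨le_rfl, dist_nonneg⟩ u hu
      have h2 := h₄ v hv _ ⟨dist_nonneg, le_rfl⟩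
      rw [h₃0, zero_sub, abs_neg, abs_of_nonneg hu.1] at h1
      rw [h₄1, abs_of_nonpos (by linarith [hv.2]), ← huv] at h2
      linarith [dist_triangle a (γ₃ u) c, hv.1, hu.2]
  -- the arc from `a` to `c` following the other two sides of the triangle
  set G := IccExtend dist_nonneg (domRestrict (Icc 0 (dist a b)) γ₁)
  have hG : Continuous G := (continuousOn_of_dist_eq h₁).domRestrict.Icc_extend'
  have hGγ : ∀ u ∈ Icc 0 (dist a b), G u = γ₁ u := fun u hu => IccExtend_of_mem _ _ hu
  have hcompact : IsCompact (Icc 0 (dist a b) ∩ G ⁻¹' (γ₂ '' Icc 0 (dist b c))) :=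
    isCompact_Icc.inter_right
      ((isCompact_Icc.image_of_continuousOn (continuousOn_of_dist_eq h₂)).isClosed.preimage hG)
  have hne : (Icc 0 (dist a b) ∩ G ⁻¹' (γ₂ '' Icc 0 (dist b c))).Nonempty :=
    ⟨dist a b, ⟨dist_nonneg, le_rfl⟩, 0, ⟨le_rfl, dist_nonneg⟩, by
      rw [hGγ _ ⟨dist_nonneg, le_rfl⟩, h₁1, h₂0]⟩
  obtain ⟨u₀, ⟨hu₀, v₀, hv₀, huv₀⟩, hmin⟩ := hcompact.exists_isLeast hne
  rw [hGγ u₀ hu₀] at huv₀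
  have hL : 0 < u₀ + (dist b c - v₀) := by
    have h1 := h₁ 0 ⟨le_rfl, dist_nonneg⟩ u₀ hu₀
    have h2 := h₂ v₀ hv₀ _ ⟨dist_nonneg, le_rfl⟩
    rw [h₁0, zero_sub, abs_neg, abs_of_nonneg hu₀.1] at h1
    rw [h₂1, abs_of_nonpos (by linarith [hv₀.2]), huv₀] at h2
    linarith [dist_triangle a (γ₁ u₀) c]
  obtain ⟨q, hq, hqinj, hq0, hq1, hqmem, -⟩ := exists_arc_of_geodesics
    (γ₁ := γ₁) (γ₂ := fun v => γ₂ (v + v₀)) hu₀.1 (sub_nonneg.2 hv₀.2) hL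
    (fun s hs t ht => h₁ s ⟨hs.1, hs.2.trans hu₀.2⟩ t ⟨ht.1, ht.2.trans hu₀.2⟩)
    (fun s hs t ht => by
      rw [h₂ _ ⟨by linarith [hs.1, hv₀.1], by linarith [hs.2]⟩ _
        ⟨by linarith [ht.1, hv₀.1], by linarith [ht.2]⟩, add_sub_add_right_eq_sub])
    (by simp [huv₀]) fun u hu v hv huv => by
      have hu' : u ∈ Icc 0 (dist a b) := ⟨hu.1, hu.2.trans hu₀.2⟩
      exact hu.2.antisymm (hmin ⟨hu', v + v₀, ⟨by linarith [hv.1, hv₀.1], by linarith [hv.2]⟩,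
        by rw [hGγ u hu', huv]⟩)
  have hrange := hT.uniquelyArcwise p q hp hq hpinj hqinj (by rw [hp0, hq0, h₃0, h₁0])
    (by rw [hp1, hq1]; simp [h₄1, h₂1])
  rw [h₃1, hrange] at hpz
  obtain ⟨t, rfl⟩ := hpz
  have hbetween : ∀ {x y : T} {γ : ℝ → T} {u : ℝ}, γ 0 = x → γ (dist x y) = y →
      (∀ s ∈ Icc 0 (dist x y), ∀ t ∈ Icc 0 (dist x y), dist (γ s) (γ t) = |s - t|) →
      u ∈ Icc 0 (dist x y) → dist x (γ u) + dist (γ u) y = dist x y := by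
    intro x y γ u h0 h1 h hu
    have e1 := h 0 ⟨le_rfl, dist_nonneg⟩ u hu
    have e2 := h u hu _ ⟨dist_nonneg, le_rfl⟩
    rw [h0, zero_sub, abs_neg, abs_of_nonneg hu.1] at e1
    rw [h1, abs_of_nonpos (by linarith [hu.2])] at e2
    linarith
  rcases hqmem t with ⟨u, hu, hut⟩ | ⟨v, hv, hvt⟩
  · rw [← hut]
    exact .inl (hbetween h₁0 h₁1 h₁ ⟨hu.1, hu.2.trans hu₀.2⟩)
  · rw [← hvt]
    exact .inr (hbetween h₂0 h₂1 h₂ ⟨by linarith [hv.1, hv₀.1], by linarith [hv.2]⟩)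

/-- If geodesic triangles are tripods, then a connected set contains the points between any two
of its points. -/
lemma IsPreconnected.mem_of_between {T : Type*} [MetricSpace T]
    (hT : ∀ a b c z : T, dist a z + dist z c = dist a c →
      dist a z + dist z b = dist a b ∨ dist b z + dist z c = dist b c)
    {S : Set T} (hS : IsPreconnected S) {a c z : T} (ha : a ∈ S) (hc : c ∈ S)
    (hz : dist a z + dist z c = dist a c) : z ∈ S := by
  by_contra hzS
  refine hS.induction₂ (fun x y => dist x z + dist z y ≠ dist x y) (fun x hx => ?_)
    (fun x y w _ _ _ h1 h2 h => (hT x y w z h).elim h1 h2)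
    (fun x y _ _ h h' => h (by linarith [dist_comm x y, dist_comm x z, dist_comm y z])) ha hc hz
  have hxz : 0 < dist x z := dist_pos.2 fun h => hzS (h ▸ hx)
  filter_upwards [nhdsWithin_le_nhds (Metric.ball_mem_nhds x hxz)] with y hy h
  rw [Metric.mem_ball, dist_comm] at hy
  linarith [dist_nonneg (x := z) (y := y)]

/-- A geodesic metric space whose geodesic triangles are tripods is an `ℝ`-tree. -/
lemma isRTree_of_between_or_between {T : Type} [MetricSpace T] [Nonempty T]
    (hgeo : ∀ x y : T, ∃ γ : ℝ → T, γ 0 = x ∧ γ (dist x y) = y ∧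
      ∀ s ∈ Icc (0:ℝ) (dist x y), ∀ t ∈ Icc (0:ℝ) (dist x y), dist (γ s) (γ t) = |s - t|)
    (hT : ∀ a b c z : T, dist a z + dist z c = dist a c →
      dist a z + dist z b = dist a b ∨ dist b z + dist z c = dist b c) : IsRTree T := by
  refine ⟨inferInstance, hgeo, fun p q hp hq hpi hqi h0 h1 => ?_, ?_⟩
  · obtain ⟨γ, hγ0, hγ1, hγ⟩ := hgeo (p 0) (p 1)
    set d := dist (p 0) (p 1)
    suffices key : ∀ r : unitInterval → T, Continuous r → Function.Injective r → r 0 = p 0 →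
        r 1 = p 1 → range r = γ '' Icc 0 d by
      rw [key p hp hpi rfl rfl, key q hq hqi h0.symm h1.symm]
    intro r hr hri hr0 hr1
    have hsub : γ '' Icc 0 d ⊆ range r := by
      rintro _ ⟨u, hu, rfl⟩
      refine (isPreconnected_range hr).mem_of_between hT ⟨0, hr0⟩ ⟨1, hr1⟩ ?_
      have e1 := hγ 0 ⟨le_rfl, dist_nonneg⟩ u hu
      have e2 := hγ u hu d ⟨dist_nonneg, le_rfl⟩
      rw [hγ0, zero_sub, abs_neg, abs_of_nonneg hu.1] at e1
      rw [hγ1, abs_of_nonpos (by linarith [hu.2])] at e2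
      linarith
    have hpre : IsPreconnected (r ⁻¹' (γ '' Icc 0 d)) := by
      have himg : IsPreconnected (γ '' Icc 0 d) :=
        isPreconnected_Icc.image γ (continuousOn_of_dist_eq hγ)
      rw [← (hr.isClosedEmbedding hri).isInducing.isPreconnected_image,
        image_preimage_eq_of_subset hsub]
      exact himg
    refine (range_subset_iff.2 fun t => ?_).antisymm hsub
    refine hpre.Icc_subset (a := 0) (b := 1) ?_ ?_ ⟨unitInterval.nonneg', unitInterval.le_one'⟩
    · exact ⟨0, ⟨le_rfl, dist_nonneg⟩, hγ0.trans hr0.symm⟩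
    · exact ⟨d, ⟨dist_nonneg, le_rfl⟩, hγ1.trans hr1.symm⟩
  · refine LocallyPathConnectedSpace.of_bases (fun x => Metric.nhds_basis_ball) fun x ε hε =>
      ⟨x, Metric.mem_ball_self hε, fun {y} hy => ?_⟩
    obtain ⟨γ, hγ0, hγ1, hγ⟩ := hgeo x y
    have hmem : MapsTo (fun t : ℝ => t * dist x y) unitInterval (Icc 0 (dist x y)) := fun t ht =>
      ⟨mul_nonneg ht.1 dist_nonneg, mul_le_of_le_one_left dist_nonneg ht.2⟩
    refine JoinedIn.ofLine (f := fun t => γ (t * dist x y))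
      ((continuousOn_of_dist_eq hγ).comp (by fun_prop) hmem) (by simpa using hγ0)
      (by simpa using hγ1) ?_
    rintro _ ⟨t, ht, rfl⟩
    have h := hγ _ (hmem ht) 0 ⟨le_rfl, dist_nonneg⟩
    rw [hγ0, sub_zero, abs_of_nonneg (hmem ht).1] at h
    rw [Metric.mem_ball] at hy ⊢
    rw [h]
    exact (hmem ht).2.trans_lt (dist_comm x y ▸ hy)

/-- A loop in an `ℝ`-tree is coded by the distance to its base point. -/
lemma IsRTree.codesLoop {T : Type} [MetricSpace T] (hT : IsRTree T) {p : unitInterval → T}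
    (hp : Continuous p) (h01 : p 0 = p 1) : CodesLoop (fun t => dist (p 0) (p t)) p := by
  refine ⟨by fun_prop, fun t => by simp, by simp [h01], fun s t hst hts => ?_⟩
  by_contra hne
  have heq := hst.le.antisymm hts.le
  have hd : 0 < dist (p s) (p t) := dist_pos.2 hne
  obtain ⟨γ, hγ0, hγ1, hγ⟩ := hT.geodesic (p s) (p t)
  set d := dist (p s) (p t)
  have e1 := hγ 0 ⟨le_rfl, hd.le⟩ (d / 2) ⟨by linarith, by linarith⟩
  have e2 := hγ (d / 2) ⟨by linarith, by linarith⟩ d ⟨hd.le, le_rfl⟩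
  rw [hγ0, abs_of_nonpos (by linarith)] at e1
  rw [hγ1, abs_of_nonpos (by linarith)] at e2
  have hz : dist (p s) (γ (d / 2)) + dist (γ (d / 2)) (p t) = dist (p s) (p t) := by linarith
  obtain ⟨u, hu, huz⟩ := (isPreconnected_uIcc.image p hp.continuousOn).mem_of_between
    (fun _ _ _ _ => hT.between_or_between) (mem_image_of_mem p left_mem_uIcc)
    (mem_image_of_mem p right_mem_uIcc) hz
  have hle := hst u hu
  simp only [huz] at hle heq
  rcases hT.between_or_between (b := p 0) hz with h | h
  · linarith [dist_comm (p 0) (p s), dist_comm (p 0) (γ (d / 2))]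
  · linarith

/-- The unit interval with the pseudometric of the tree coded by `g`. -/
def PreTree (_ : C(unitInterval, ℝ)) : Type := unitInterval

namespace PreTree

variable (g : C(unitInterval, ℝ))

/-- The minimal height between two points. -/
noncomputable def meet (s t : unitInterval) : ℝ := sInf (g '' uIcc s t)

lemma exists_meet_eq (s t : unitInterval) :
    ∃ m ∈ uIcc s t, LiesBelow g m s ∧ LiesBelow g m t ∧ meet g s t = g m := by
  obtain ⟨m, hm, hmin, hs, ht⟩ := exists_liesBelow_both g.continuous s t
  exact ⟨m, hm, hs, ht, IsLeast.csInf_eq ⟨mem_image_of_mem g hm, forall_mem_image.2 hmin⟩⟩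

lemma meet_le {s t u : unitInterval} (hu : u ∈ uIcc s t) : meet g s t ≤ g u :=
  csInf_le (isCompact_uIcc.image g.continuous).bddBelow (mem_image_of_mem g hu)

lemma meet_self (s : unitInterval) : meet g s s = g s := by simp [meet]

lemma meet_comm (s t : unitInterval) : meet g s t = meet g t s := by rw [meet, uIcc_comm, meet]

lemma meet_ultrametric (r s t : unitInterval) :
    meet g r s ≤ meet g r t ∨ meet g s t ≤ meet g r t := by
  obtain ⟨m, hm, -, -, h⟩ := exists_meet_eq g r t
  rw [h]
  exact (uIcc_subset_uIcc_union_uIcc (b := s) hm).imp (meet_le g) (meet_le g)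

variable {g} in
lemma meet_eq_left {s t : unitInterval} : meet g s t = g s ↔ LiesBelow g s t := by
  refine ⟨fun h u hu => h ▸ meet_le g hu, fun h => (meet_le g left_mem_uIcc).antisymm ?_⟩
  obtain ⟨m, hm, -, -, h'⟩ := exists_meet_eq g s t
  exact h' ▸ h m hm

/-- The distance in the tree coded by `g`. -/
noncomputable def treeDist (s t : unitInterval) : ℝ := g s + g t - 2 * meet g s t

lemma treeDist_self (s : unitInterval) : treeDist g s s = 0 := by
  rw [treeDist, meet_self]
  ring

lemma treeDist_comm (s t : unitInterval) : treeDist g s t = treeDist g t s := by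
  rw [treeDist, treeDist, meet_comm]
  ring

lemma treeDist_triangle (r s t : unitInterval) :
    treeDist g r t ≤ treeDist g r s + treeDist g s t := by
  unfold treeDist
  have h1 : meet g r s ≤ g s := meet_le g right_mem_uIcc
  have h2 : meet g s t ≤ g s := meet_le g left_mem_uIcc
  rcases meet_ultrametric g r s t with h | h <;> linarith

lemma treeDist_nonneg (s t : unitInterval) : 0 ≤ treeDist g s t := by
  have h1 : meet g s t ≤ g s := meet_le g left_mem_uIcc
  have h2 : meet g s t ≤ g t := meet_le g right_mem_uIcc
  unfold treeDist
  linarith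

lemma between_or_between (a b c z : unitInterval)
    (hz : treeDist g a z + treeDist g z c = treeDist g a c) :
    treeDist g a z + treeDist g z b = treeDist g a b ∨
      treeDist g b z + treeDist g z c = treeDist g b c := by
  simp only [treeDist] at hz ⊢
  have h1 := meet_ultrametric g a z c
  have h2 : meet g a z ≤ g z := meet_le g right_mem_uIcc
  have h3 : meet g z c ≤ g z := meet_le g left_mem_uIcc
  have h4 : meet g z b ≤ g z := meet_le g left_mem_uIcc
  have h5 := meet_ultrametric g a z b
  have h6 := meet_ultrametric g a b z
  have h7 := meet_ultrametric g b z c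
  have h8 := meet_ultrametric g z b c
  have h9 := meet_ultrametric g a b c
  have h10 := meet_ultrametric g z a b
  have h11 := meet_ultrametric g b c z
  rw [meet_comm g z a] at h10
  rw [meet_comm g b z] at *
  rw [meet_comm g c z] at h11
  grind

lemma eq_of_treeDist_eq_zero {X : Type*} {γ : unitInterval → X} (h : CodesLoop g γ)
    {s t : unitInterval} (hst : treeDist g s t = 0) : γ s = γ t := by
  rw [treeDist] at hst
  have h1 : meet g s t ≤ g s := meet_le g left_mem_uIcc
  have h2 : meet g s t ≤ g t := meet_le g right_mem_uIcc
  refine h.eq_of_liesBelow s t (meet_eq_left.1 (by linarith)) (meet_eq_left.1 ?_)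
  rw [meet_comm]
  linarith

variable {g} in
lemma treeDist_of_liesBelow {s t : unitInterval} (h : LiesBelow g s t) :
    treeDist g s t = g t - g s := by
  rw [treeDist, meet_eq_left.2 h]
  ring

variable {g} in
lemma treeDist_eq_abs {r s t : unitInterval} (h : LiesBelow g r t) (h' : LiesBelow g s t) :
    treeDist g r s = |g r - g s| := by
  rcases le_total (g r) (g s) with hrs | hrs
  · rw [treeDist_of_liesBelow (h.of_le h' hrs), abs_of_nonpos (by linarith)]
    ring
  · rw [treeDist_comm, treeDist_of_liesBelow (h'.of_le h hrs), abs_of_nonneg (by linarith)]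

lemma exists_geodesic (s t : unitInterval) : ∃ γ : ℝ → unitInterval,
    treeDist g (γ 0) s = 0 ∧ treeDist g (γ (treeDist g s t)) t = 0 ∧
      ∀ u ∈ Icc 0 (treeDist g s t), ∀ v ∈ Icc 0 (treeDist g s t),
        treeDist g (γ u) (γ v) = |u - v| := by
  obtain ⟨m, hm, hms, hmt, hmeet⟩ := exists_meet_eq g s t
  have hd : treeDist g s t = (g s - g m) + (g t - g m) := by rw [treeDist, hmeet]; ring
  have ha := hms.le
  have hb := hmt.le
  let P (u : ℝ) (w : unitInterval) : Prop :=
    (u ≤ g s - g m ∧ w ∈ uIcc m s ∧ LiesBelow g w s ∧ g w = g s - u) ∨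
    (g s - g m ≤ u ∧ w ∈ uIcc m t ∧ LiesBelow g w t ∧ g w = u - g s + 2 * g m)
  have hex : ∀ u, ∃ w, u ∈ Icc 0 (treeDist g s t) → P u w := by
    intro u
    by_cases hu : u ∈ Icc 0 (treeDist g s t)
    · rw [hd] at hu
      rcases le_total u (g s - g m) with h | h
      · obtain ⟨w, hw, hws, hwu⟩ := exists_liesBelow_of_height g.continuous
          (m := m) (s := s) (r := g s - u) (by linarith) (by linarith [hu.1])
        exact ⟨w, fun _ => .inl ⟨h, hw, hws, hwu⟩⟩
      · obtain ⟨w, hw, hws, hwu⟩ := exists_liesBelow_of_height g.continuous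
          (m := m) (s := t) (r := u - g s + 2 * g m) (by linarith) (by linarith [hu.2])
        exact ⟨w, fun _ => .inr ⟨h, hw, hws, hwu⟩⟩
    · exact ⟨s, fun h => absurd h hu⟩
  have hmixed : ∀ {u v : ℝ} {w w' : unitInterval}, u ≤ g s - g m → g s - g m ≤ v →
      w ∈ uIcc m s → w' ∈ uIcc m t → LiesBelow g w s → LiesBelow g w' t →
      g w = g s - u → g w' = v - g s + 2 * g m →
      treeDist g w w' = v - u := by
    intro u v w w' hu hv hw hw' hws hwt hwu hwv
    have hmem : m ∈ uIcc w w' := by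
      rw [mem_uIcc] at hm hw hw' ⊢
      grind
    have hle : meet g w w' = g m := by
      refine (meet_le g hmem).antisymm ?_
      have h1 : LiesBelow g m w := hms.of_le hws (by linarith)
      have h2 : LiesBelow g m w' := hmt.of_le hwt (by linarith)
      obtain ⟨x, hx, -, -, h⟩ := exists_meet_eq g w w'
      rw [h]
      rcases uIcc_subset_uIcc_union_uIcc (b := m) hx with hx | hx
      · exact h1 x (uIcc_comm m w ▸ hx)
      · exact h2 x hx
    rw [treeDist, hle, hwu, hwv]
    ring
  have hP : ∀ {u v : ℝ} {w w' : unitInterval}, P u w → P v w' →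
      treeDist g w w' = |u - v| := by
    rintro u v w w' (⟨hu, hw, hws, hwu⟩ | ⟨hu, hw, hws, hwu⟩)
      (⟨hv, hw', hws', hwv⟩ | ⟨hv, hw', hws', hwv⟩)
    · rw [treeDist_eq_abs hws hws', hwu, hwv, abs_sub_comm]
      congr 1
      ring
    · rw [hmixed hu hv hw hw' hws hws' hwu hwv, abs_of_nonpos (by linarith)]
      ring
    · rw [treeDist_comm, hmixed hv hu hw' hw hws' hws hwv hwu, abs_of_nonneg (by linarith)]
    · rw [treeDist_eq_abs hws hws', hwu, hwv]
      congr 1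
      ring
  choose γ hγ using hex
  refine ⟨γ, ?_, ?_, fun u hu v hv => hP (hγ u hu) (hγ v hv)⟩
  · have : P 0 s := .inl ⟨by linarith, right_mem_uIcc, .refl g s, by ring⟩
    rw [hP (hγ 0 ⟨le_rfl, treeDist_nonneg g s t⟩) this, sub_zero, abs_zero]
  · have : P (treeDist g s t) t := .inr ⟨by linarith, right_mem_uIcc, .refl g t, by linarith⟩
    rw [hP (hγ _ ⟨treeDist_nonneg g s t, le_rfl⟩) this, sub_self, abs_zero]

noncomputable instance : PseudoMetricSpace (PreTree g) where
  dist := treeDist g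
  dist_self := treeDist_self g
  dist_comm := treeDist_comm g
  dist_triangle := treeDist_triangle g

lemma isRTree : IsRTree (SeparationQuotient (PreTree g)) := by
  have : Nonempty (PreTree g) := ⟨(0 : unitInterval)⟩
  apply isRTree_of_between_or_between
  · intro x y
    obtain ⟨s, rfl⟩ := SeparationQuotient.surjective_mk x
    obtain ⟨t, rfl⟩ := SeparationQuotient.surjective_mk y
    obtain ⟨γ, h0, h1, h⟩ := exists_geodesic g s t
    refine ⟨SeparationQuotient.mk ∘ γ, ?_, ?_, h⟩
    · exact SeparationQuotient.mk_eq_mk.2 (Metric.inseparable_iff.2 h0)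
    · exact SeparationQuotient.mk_eq_mk.2 (Metric.inseparable_iff.2 h1)
  · intro a b c z
    obtain ⟨a, rfl⟩ := SeparationQuotient.surjective_mk a
    obtain ⟨b, rfl⟩ := SeparationQuotient.surjective_mk b
    obtain ⟨c, rfl⟩ := SeparationQuotient.surjective_mk c
    obtain ⟨z, rfl⟩ := SeparationQuotient.surjective_mk z
    exact between_or_between g a b c z

/-- The projection of the unit interval onto the tree coded by `g`. -/
noncomputable def proj (t : unitInterval) : SeparationQuotient (PreTree g) :=
  SeparationQuotient.mk (X := PreTree g) t

lemma dist_proj (s t : unitInterval) : dist (proj g s) (proj g t) = treeDist g s t :=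
  rfl

lemma surjective_proj : Function.Surjective (proj g) :=
  SeparationQuotient.surjective_mk (X := PreTree g)

lemma continuous_proj : Continuous (proj g) := by
  refine Metric.continuous_iff.2 fun s ε hε => ?_
  obtain ⟨δ, hδ, h⟩ := Metric.uniformContinuous_iff.1
    (CompactSpace.uniformContinuous_of_continuous g.continuous) (ε / 2) (half_pos hε)
  refine ⟨δ, hδ, fun t ht => ?_⟩
  obtain ⟨m, hm, -, -, hmeet⟩ := exists_meet_eq g t s
  rw [dist_proj, treeDist, hmeet]
  have h1 := h ((dist_le_of_mem_uIcc left_mem_uIcc hm).trans_lt ht)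
  have h2 := h ((dist_le_of_mem_uIcc right_mem_uIcc hm).trans_lt ht)
  rw [Real.dist_eq] at h1 h2
  linarith [le_abs_self (g t - g m), le_abs_self (g s - g m)]

end PreTree

/-- A coded loop factors through an `ℝ`-tree. -/
lemma CodesLoop.exists_isRTree {X : Type*} [TopologicalSpace X] {g : unitInterval → ℝ}
    {γ : unitInterval → X} (h : CodesLoop g γ) (hγ : Continuous γ) :
    ∃ (T : Type) (_ : MetricSpace T), IsRTree T ∧ ∃ (f : T → X) (ℓ : unitInterval → T),
      Continuous f ∧ Continuous ℓ ∧ ℓ 0 = ℓ 1 ∧ f ∘ ℓ = γ := by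
  lift g to C(unitInterval, ℝ) using h.continuous
  have hf : (γ ∘ Function.surjInv (PreTree.surjective_proj g)) ∘ PreTree.proj g = γ := by
    ext t
    refine PreTree.eq_of_treeDist_eq_zero g h ?_
    exact dist_eq_zero.2 (Function.surjInv_eq (PreTree.surjective_proj g) (PreTree.proj g t))
  refine ⟨_, inferInstance, PreTree.isRTree g, _, PreTree.proj g, ?_, PreTree.continuous_proj g,
    ?_, hf⟩
  · rw [((PreTree.continuous_proj g).isClosedMap.isQuotientMap (PreTree.continuous_proj g)
      (PreTree.surjective_proj g)).continuous_iff, hf]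
    exact hγ
  · rw [← dist_eq_zero, PreTree.dist_proj, PreTree.treeDist_of_liesBelow (h.liesBelow_zero 1),
      h.one_eq, sub_self]

section ConcatReverse

variable {X Y : Type*}

lemma concatReverse_zero (p q : unitInterval → X) : ConcatReverse p q 0 = p 0 := by
  simp [ConcatReverse]

lemma concatReverse_one (p q : unitInterval → X) : ConcatReverse p q 1 = q 0 := by
  norm_num [ConcatReverse]

lemma comp_concatReverse (f : X → Y) (p q : unitInterval → X) :
    f ∘ ConcatReverse p q = ConcatReverse (f ∘ p) (f ∘ q) := by
  ext t
  simp only [ConcatReverse, Function.comp_apply, apply_ite f]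

lemma continuous_concatReverse [TopologicalSpace X] {p q : unitInterval → X} (hp : Continuous p)
    (hq : Continuous q) (h : p 1 = q 1) : Continuous (ConcatReverse p q) := by
  refine Continuous.if_le (by fun_prop) (by fun_prop) (by fun_prop) (by fun_prop) fun t ht => ?_
  rw [ht]
  norm_num [h]

/-- The first half of the unit interval. -/
noncomputable def firstHalf (t : unitInterval) : unitInterval :=
  ⟨t / 2, by linarith [t.2.1], by linarith [t.2.2]⟩

/-- The second half of the unit interval, run through backwards. -/
noncomputable def secondHalf (t : unitInterval) : unitInterval :=
  ⟨1 - t / 2, by linarith [t.2.2], by linarith [t.2.1]⟩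

lemma continuous_firstHalf : Continuous firstHalf :=
  (by fun_prop : Continuous fun t : unitInterval => (t : ℝ) / 2).subtype_mk _

lemma continuous_secondHalf : Continuous secondHalf :=
  (by fun_prop : Continuous fun t : unitInterval => 1 - (t : ℝ) / 2).subtype_mk _

lemma concatReverse_comp_firstHalf (p q : unitInterval → X) :
    ConcatReverse p q ∘ firstHalf = p := by
  ext t
  have h : (t : ℝ) / 2 ≤ 1 / 2 := by linarith [t.2.2]
  simp only [ConcatReverse, firstHalf, Function.comp_apply, if_pos h, mul_div_cancel₀ (t : ℝ)
    (two_ne_zero' ℝ), projIcc_val]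

lemma concatReverse_comp_secondHalf {p q : unitInterval → X} (h : p 1 = q 1) :
    ConcatReverse p q ∘ secondHalf = q := by
  ext t
  rcases t.2.2.eq_or_lt with ht | ht
  · obtain rfl : t = 1 := Subtype.ext ht
    norm_num [ConcatReverse, secondHalf, h]
  · have h' : ¬ 1 - (t : ℝ) / 2 ≤ 1 / 2 := by linarith
    have e : 2 - 2 * (1 - (t : ℝ) / 2) = t := by ring
    simp only [ConcatReverse, secondHalf, Function.comp_apply, if_neg h', e, projIcc_val]

lemma firstHalf_one : firstHalf 1 = secondHalf 1 := by
  ext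
  norm_num [firstHalf, secondHalf]

lemma firstHalf_zero : firstHalf 0 = 0 := by
  ext
  simp [firstHalf]

lemma secondHalf_zero : secondHalf 0 = 1 := by
  ext
  simp [secondHalf]

lemma monotone_concatReverse_halves {b b' : unitInterval → unitInterval} (hb : Monotone b)
    (hb' : Monotone b') : Monotone (ConcatReverse (firstHalf ∘ b) (secondHalf ∘ b')) := by
  intro s t hst
  have hst' : (s : ℝ) ≤ t := hst
  unfold ConcatReverse
  split_ifs with hs ht ht
  · have := hb (monotone_projIcc (zero_le_one' ℝ) (by linarith : 2 * (s : ℝ) ≤ 2 * t))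
    simp only [← Subtype.coe_le_coe, firstHalf, Function.comp_apply] at this ⊢
    linarith
  · rw [← Subtype.coe_le_coe]
    simp only [firstHalf, secondHalf, Function.comp_apply]
    linarith [(b (projIcc 0 1 zero_le_one (2 * (s : ℝ)))).2.2,
      (b' (projIcc 0 1 zero_le_one (2 - 2 * (t : ℝ)))).2.2]
  · linarith
  · have := hb' (monotone_projIcc (zero_le_one' ℝ) (by linarith : 2 - 2 * (t : ℝ) ≤ 2 - 2 * s))
    simp only [← Subtype.coe_le_coe, secondHalf, Function.comp_apply] at this ⊢
    linarith

end ConcatReverse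

lemma FrechetEquiv.apply_endpoints {X : Type*} {α β : unitInterval → X} (h : FrechetEquiv α β) :
    α 0 = β 0 ∧ α 1 = β 1 := by
  obtain ⟨a, b, -, -, ha, hb, has, hbs, hab⟩ := h
  have h0 := congrFun hab ⊥
  have h1 := congrFun hab ⊤
  simp only [Function.comp_apply, ha.map_bot_of_surjective has, hb.map_bot_of_surjective hbs] at h0
  simp only [Function.comp_apply, ha.map_top_of_surjective has, hb.map_top_of_surjective hbs] at h1
  exact ⟨h0, h1⟩

/-- `≃ᵣ` is invariant under Fréchet equivalence. -/
theorem rTreeHomotopic_of_frechet {X : Type*} [TopologicalSpace X] [T2Space X]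
    (α₁ α₂ β₁ β₂ : unitInterval → X)
    (hα₁ : Continuous α₁) (hα₂ : Continuous α₂) (hβ₁ : Continuous β₁) (hβ₂ : Continuous β₂)
    (h : RTreeHomotopic α₁ α₂)
    (h₁ : FrechetEquiv α₁ β₁) (h₂ : FrechetEquiv α₂ β₂) :
    RTreeHomotopic β₁ β₂ := by
  obtain ⟨h0, h1, T, _, hT, f, ℓ, hf, hℓ, hℓ01, hfℓ⟩ := h
  have hβ0 : β₁ 0 = β₂ 0 := by rw [← h₁.apply_endpoints.1, h0, h₂.apply_endpoints.1]
  have hβ1 : β₁ 1 = β₂ 1 := by rw [← h₁.apply_endpoints.2, h1, h₂.apply_endpoints.2]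
  obtain ⟨a₁, b₁, ha₁, hb₁, ma₁, mb₁, sa₁, sb₁, hab₁⟩ := h₁
  obtain ⟨a₂, b₂, ha₂, hb₂, ma₂, mb₂, sa₂, sb₂, hab₂⟩ := h₂
  have a₁0 : a₁ 0 = 0 := ma₁.map_bot_of_surjective sa₁
  have a₂0 : a₂ 0 = 0 := ma₂.map_bot_of_surjective sa₂
  have a₁1 : a₁ 1 = 1 := ma₁.map_top_of_surjective sa₁
  have a₂1 : a₂ 1 = 1 := ma₂.map_top_of_surjective sa₂
  have b₁0 : b₁ 0 = 0 := mb₁.map_bot_of_surjective sb₁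
  have b₂0 : b₂ 0 = 0 := mb₂.map_bot_of_surjective sb₂
  have b₁1 : b₁ 1 = 1 := mb₁.map_top_of_surjective sb₁
  have b₂1 : b₂ 1 = 1 := mb₂.map_top_of_surjective sb₂
  -- the loop in the tree reparametrized by `a₁` and `a₂`
  set L := ConcatReverse (ℓ ∘ firstHalf ∘ a₁) (ℓ ∘ secondHalf ∘ a₂) with hLdef
  have hL : Continuous L := continuous_concatReverse
    (hℓ.comp (continuous_firstHalf.comp ha₁)) (hℓ.comp (continuous_secondHalf.comp ha₂))
    (by simp [a₁1, a₂1, firstHalf_one])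
  have hL01 : L 0 = L 1 := by
    simp [hLdef, concatReverse_zero, concatReverse_one, a₁0, a₂0, firstHalf_zero, secondHalf_zero,
      hℓ01]
  -- the reparametrization of the loop formed by `β₁` and `β₂`
  set B := ConcatReverse (firstHalf ∘ b₁) (secondHalf ∘ b₂) with hBdef
  have hB : Continuous B := continuous_concatReverse (continuous_firstHalf.comp hb₁)
    (continuous_secondHalf.comp hb₂) (by simp [b₁1, b₂1, firstHalf_one])
  have hBsurj : Function.Surjective B := by
    have h0 : B 0 = 0 := by simp [hBdef, concatReverse_zero, b₁0, firstHalf_zero]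
    have h1 : B 1 = 1 := by simp [hBdef, concatReverse_one, b₂0, secondHalf_zero]
    intro y
    exact mem_range_of_exists_le_of_exists_ge hB ⟨0, by rw [h0]; exact unitInterval.nonneg'⟩
      ⟨1, by rw [h1]; exact unitInterval.le_one'⟩
  have hfL : f ∘ L = ConcatReverse β₁ β₂ ∘ B := by
    rw [hLdef, hBdef, comp_concatReverse, comp_concatReverse, ← Function.comp_assoc f,
      ← Function.comp_assoc f, ← Function.comp_assoc _ firstHalf,
      ← Function.comp_assoc _ secondHalf, ← Function.comp_assoc _ firstHalf,
      ← Function.comp_assoc _ secondHalf, hfℓ,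
      concatReverse_comp_firstHalf, concatReverse_comp_firstHalf, concatReverse_comp_secondHalf h1,
      concatReverse_comp_secondHalf hβ1, hab₁, hab₂]
  have hcode := hT.codesLoop hL hL01
  have hcode' : CodesLoop (fun t => dist (L 0) (L t)) (ConcatReverse β₁ β₂ ∘ B) :=
    ⟨hcode.continuous, hcode.zero_le, hcode.one_eq, fun s t hst hts => by
      rw [← hfL, Function.comp_apply, hcode.eq_of_liesBelow s t hst hts, Function.comp_apply]⟩
  have hβ := continuous_concatReverse hβ₁ hβ₂ hβ1
  obtain ⟨g, hg⟩ := hcode'.exists_of_comp hβ hB (monotone_concatReverse_halves mb₁ mb₂) hBsurj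
  exact ⟨hβ0, hβ1, hg.exists_isRTree hβ⟩
end

section
/- Let U₁ and U₂ be staggered Cantor complements. Then for i ∈ {1,2} there exists a set 𝒰ᵢ of connected components of Uᵢ such that 𝒰ᵢ, ordered by the position of its members in (0,1), is order-isomorphic to ℤ, the infimum of ⋃𝒰ᵢ is 0, the supremum of ⋃𝒰ᵢ is 1, and the sets ⋃𝒰₁ and ⋃𝒰₂ are staggered. -/
open Set Filter Topology

/-- No point of the Cantor set is isolated. -/
theorem accPt_nat_bool (x : ℕ → Bool) {V : Set (ℕ → Bool)} (hV : V ∈ 𝓝 x) :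
    ∃ y ∈ V, y ≠ x := by
  have hlim : Tendsto (fun n : ℕ => Function.update x n (!x n)) atTop (𝓝 x) := by
    rw [tendsto_pi_nhds]
    intro i
    refine tendsto_const_nhds.congr' ?_
    filter_upwards [eventually_gt_atTop i] with n hn
    rw [Function.update_of_ne hn.ne]
  obtain ⟨n, hn⟩ := (hlim.eventually hV).exists
  refine ⟨_, hn, fun h => ?_⟩
  simpa using congrFun h n

/-- A subset of a topological space homeomorphic to the Cantor set is preperfect. -/
theorem preperfect_of_homeomorph_cantor {X : Type*} [TopologicalSpace X] {C : Set X}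
    (h : C ≃ₜ (ℕ → Bool)) : Preperfect C := by
  rw [preperfect_iff_nhds]
  intro x hx V hV
  have hV' : h.symm ⁻¹' (Subtype.val ⁻¹' V) ∈ 𝓝 (h ⟨x, hx⟩) := by
    refine h.symm.continuous.continuousAt.preimage_mem_nhds ?_
    rw [h.symm_apply_apply]
    exact continuous_subtype_val.continuousAt.preimage_mem_nhds hV
  obtain ⟨y, hyV, hy⟩ := accPt_nat_bool _ hV'
  refine ⟨h.symm y, ⟨hyV, (h.symm y).2⟩, fun hxy => hy ?_⟩
  rw [← h.apply_symm_apply y]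
  exact congrArg h (Subtype.ext hxy)

theorem IsCantorComplement.exists_notMem_lt {U : Set ℝ} (hU : IsCantorComplement U) {ε : ℝ}
    (hε : 0 < ε) : ∃ x ∈ Ioo (0 : ℝ) 1, x < ε ∧ x ∉ U := by
  obtain ⟨-, hsub, ⟨h⟩⟩ := hU
  have h0 : (0 : ℝ) ∈ Icc (0 : ℝ) 1 \ U := ⟨by simp, fun h => lt_irrefl _ (hsub h).1⟩
  obtain ⟨y, ⟨hy, ⟨hy0, -⟩, hyU⟩, hne⟩ := preperfect_iff_nhds.1
    (preperfect_of_homeomorph_cantor h) 0 h0 _ (Iio_mem_nhds (lt_min hε one_pos))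
  rw [mem_Iio, lt_min_iff] at hy
  exact ⟨y, ⟨lt_of_le_of_ne hy0 hne.symm, hy.2⟩, hy.1, hyU⟩

theorem IsCantorComplement.exists_notMem_gt {U : Set ℝ} (hU : IsCantorComplement U) {ε : ℝ}
    (hε : ε < 1) : ∃ x ∈ Ioo (0 : ℝ) 1, ε < x ∧ x ∉ U := by
  obtain ⟨-, hsub, ⟨h⟩⟩ := hU
  have h1 : (1 : ℝ) ∈ Icc (0 : ℝ) 1 \ U := ⟨by simp, fun h => lt_irrefl _ (hsub h).2⟩
  obtain ⟨y, ⟨hy, ⟨-, hy1⟩, hyU⟩, hne⟩ := preperfect_iff_nhds.1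
    (preperfect_of_homeomorph_cantor h) 1 h1 _ (Ioi_mem_nhds (max_lt hε one_pos))
  rw [mem_Ioi, max_lt_iff] at hy
  exact ⟨y, ⟨hy.2, lt_of_le_of_ne hy1 hne⟩, hy.1, hyU⟩

/-- A nonempty set of reals without least or greatest element, each of whose order intervals is
finite, is order-isomorphic to `ℤ`. -/
theorem nonempty_orderIso_int {P : Set ℝ} (hne : P.Nonempty)
    (hmin : ∀ p ∈ P, ∃ q ∈ P, q < p) (hmax : ∀ p ∈ P, ∃ q ∈ P, p < q)
    (hfin : ∀ p ∈ P, ∀ q ∈ P, (P ∩ Icc p q).Finite) : Nonempty (P ≃o ℤ) := by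
  let _ : LocallyFiniteOrder P := LocallyFiniteOrder.ofFiniteIcc fun a b =>
    ((hfin a a.2 b b.2).preimage Subtype.val_injective.injOn).subset
      fun x hx => ⟨x.2, hx.1, hx.2⟩
  let _ := LinearLocallyFiniteOrder.succOrder P
  let _ := LinearLocallyFiniteOrder.predOrder P
  have : NoMaxOrder P := ⟨fun a => by
    obtain ⟨q, hq, h⟩ := hmax a a.2
    exact ⟨⟨q, hq⟩, h⟩⟩
  have : NoMinOrder P := ⟨fun a => by
    obtain ⟨q, hq, h⟩ := hmin a a.2
    exact ⟨⟨q, hq⟩, h⟩⟩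
  have : Nonempty P := hne.to_subtype
  exact ⟨orderIsoIntOfLinearSuccPredArch⟩

/-- If `p < q` lie in distinct components of `U`, then every point of the first component is
below every point of the second. -/
theorem lt_of_mem_connectedComponentIn {U : Set ℝ} {p q x y : ℝ} (hp : p ∈ U) (hq : q ∈ U)
    (hpq : p < q) (hne : connectedComponentIn U p ≠ connectedComponentIn U q)
    (hx : x ∈ connectedComponentIn U p) (hy : y ∈ connectedComponentIn U q) : x < y := by
  by_contra! hyx
  have hpp := mem_connectedComponentIn hp
  have hqq := mem_connectedComponentIn hq
  have hJ := (isPreconnected_connectedComponentIn (x := p) (F := U)).ordConnected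
  have hL := (isPreconnected_connectedComponentIn (x := q) (F := U)).ordConnected
  apply hne
  rcases le_total x q with h | h
  · have := hL.out hy hqq ⟨hyx, h⟩
    rw [connectedComponentIn_eq hx, connectedComponentIn_eq this]
  · have := hJ.out hpp hx ⟨hpq.le, h⟩
    rw [connectedComponentIn_eq this]

/-- Let `U ⊆ (0,1)` be open with complement accumulating at `0` and `1`, and let `C ∩ (0,1)` be a
relatively closed subset of `(0,1)` that is contained in `U` and accumulates at `0` and `1`. Then
the components of `U` that meet `C` form a `ℤ`-ordered family. -/
theorem exists_int_indexed_components {U C : Set ℝ} (hU : IsOpen U) (hU01 : U ⊆ Ioo 0 1)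
    (hC : IsClosed C) (hCU : C ∩ Ioo 0 1 ⊆ U)
    (hU0 : ∀ ε > 0, ∃ x ∈ Ioo (0 : ℝ) 1, x < ε ∧ x ∉ U)
    (hU1 : ∀ ε < 1, ∃ x ∈ Ioo (0 : ℝ) 1, ε < x ∧ x ∉ U)
    (hC0 : ∀ ε > 0, ∃ x ∈ Ioo (0 : ℝ) 1, x < ε ∧ x ∈ C)
    (hC1 : ∀ ε < 1, ∃ x ∈ Ioo (0 : ℝ) 1, ε < x ∧ x ∈ C) :
    ∃ e : ℤ → Set ℝ,
      (∀ n, ∃ x ∈ U, e n = connectedComponentIn U x) ∧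
      Function.Injective e ∧
      (∀ m n : ℤ, m < n → ∀ x ∈ e m, ∀ y ∈ e n, x < y) ∧
      sInf (⋃ n, e n) = 0 ∧ sSup (⋃ n, e n) = 1 ∧
      ∀ x ∈ C ∩ Ioo 0 1, connectedComponentIn U x ⊆ ⋃ n, e n := by
  set K := C ∩ Ioo (0 : ℝ) 1 with hK
  have hrep : ∀ S : Set ℝ, ∃ p, (S ∩ K).Nonempty → p ∈ S ∩ K := fun S => by
    by_cases h : (S ∩ K).Nonempty
    · exact ⟨h.some, fun h' => h.some_mem⟩
    · exact ⟨0, fun h' => absurd h' h⟩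
  choose f hf using hrep
  have hfK : ∀ x ∈ K, f (connectedComponentIn U x) ∈ connectedComponentIn U x ∩ K := fun x hx =>
    hf _ ⟨x, mem_connectedComponentIn (hCU hx), hx⟩
  set P := (fun x => f (connectedComponentIn U x)) '' K with hP
  have hPK : P ⊆ K := by
    rintro _ ⟨x, hx, rfl⟩
    exact (hfK x hx).2
  have hfP : ∀ p ∈ P, f (connectedComponentIn U p) = p := by
    rintro _ ⟨x, hx, rfl⟩
    exact congrArg f (connectedComponentIn_eq (hfK x hx).1).symm
  have hinj : ∀ p ∈ P, ∀ q ∈ P, connectedComponentIn U p = connectedComponentIn U q → p = q :=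
    fun p hp q hq h => by rw [← hfP p hp, h, hfP q hq]
  have hmin : ∀ p ∈ Ioo (0 : ℝ) 1, ∃ q ∈ P, q < p := by
    intro p hp
    obtain ⟨y, hy01, hyp, hyU⟩ := hU0 p hp.1
    obtain ⟨x, hx01, hxy, hxC⟩ := hC0 y hy01.1
    have hx : x ∈ K := ⟨hxC, hx01⟩
    refine ⟨_, ⟨x, hx, rfl⟩, lt_of_not_ge fun h => hyU ?_⟩
    exact connectedComponentIn_subset U x <|
      isPreconnected_connectedComponentIn.ordConnected.out (mem_connectedComponentIn (hCU hx))
        (hfK x hx).1 ⟨hxy.le, hyp.le.trans h⟩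
  have hmax : ∀ p ∈ Ioo (0 : ℝ) 1, ∃ q ∈ P, p < q := by
    intro p hp
    obtain ⟨y, hy01, hyp, hyU⟩ := hU1 p hp.2
    obtain ⟨x, hx01, hxy, hxC⟩ := hC1 y hy01.2
    have hx : x ∈ K := ⟨hxC, hx01⟩
    refine ⟨_, ⟨x, hx, rfl⟩, lt_of_not_ge fun h => hyU ?_⟩
    exact connectedComponentIn_subset U x <|
      isPreconnected_connectedComponentIn.ordConnected.out (hfK x hx).1
        (mem_connectedComponentIn (hCU hx)) ⟨h.trans hyp.le, hxy.le⟩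
  have hfin : ∀ p ∈ P, ∀ q ∈ P, (P ∩ Icc p q).Finite := by
    intro p hp q hq
    have hsub : C ∩ Icc p q ⊆ K := fun x hx =>
      ⟨hx.1, (hPK hp).2.1.trans_le hx.2.1, hx.2.2.trans_lt (hPK hq).2.2⟩
    obtain ⟨t, ht, hcov⟩ := (isCompact_Icc.inter_left hC).elim_nhds_subcover
      (fun x => connectedComponentIn U x) fun x hx =>
        hU.connectedComponentIn.mem_nhds (mem_connectedComponentIn (hCU (hsub hx)))
    refine (t.finite_toSet.image fun x => f (connectedComponentIn U x)).subset ?_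
    rintro x ⟨hxP, hx⟩
    obtain ⟨y, hy, hxy⟩ := mem_iUnion₂.1 (hcov ⟨(hPK hxP).1, hx⟩)
    exact ⟨y, hy, by rw [← hfP x hxP]; exact congrArg f (connectedComponentIn_eq hxy)⟩
  obtain ⟨q₀, hq₀, -⟩ := hmin (1 / 2) (by norm_num)
  obtain ⟨φ⟩ := nonempty_orderIso_int ⟨q₀, hq₀⟩ (fun p hp => hmin p (hPK hp).2)
    (fun p hp => hmax p (hPK hp).2) hfin
  have hφU : ∀ n, (φ.symm n : ℝ) ∈ U := fun n => hCU (hPK (φ.symm n).2)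
  have hφinj : Function.Injective fun n => connectedComponentIn U (φ.symm n : ℝ) := fun m n h =>
    φ.symm.injective (Subtype.ext (hinj _ (φ.symm m).2 _ (φ.symm n).2 h))
  have hPmem : ∀ p ∈ P, connectedComponentIn U p ⊆ ⋃ n, connectedComponentIn U (φ.symm n) :=
    fun p hp => by
      have := subset_iUnion (fun n => connectedComponentIn U (φ.symm n : ℝ)) (φ ⟨p, hp⟩)
      simpa using this
  have hPmem' : ∀ p ∈ P, p ∈ ⋃ n, connectedComponentIn U (φ.symm n) := fun p hp =>
    hPmem p hp (mem_connectedComponentIn (hCU (hPK hp)))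
  have hsub : (⋃ n, connectedComponentIn U (φ.symm n : ℝ)) ⊆ Ioo 0 1 :=
    iUnion_subset fun n => (connectedComponentIn_subset _ _).trans hU01
  refine ⟨fun n => connectedComponentIn U (φ.symm n), fun n => ⟨_, hφU n, rfl⟩, hφinj,
    fun m n hmn x hx y hy => lt_of_mem_connectedComponentIn (hφU m) (hφU n)
      (φ.symm.strictMono hmn) (hφinj.ne hmn.ne) hx hy, ?_, ?_, fun x hx => ?_⟩
  · refine csInf_eq_of_forall_ge_of_forall_gt_exists_lt ⟨q₀, hPmem' q₀ hq₀⟩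
      (fun x hx => (hsub hx).1.le) fun w hw => ?_
    obtain ⟨x, hx01, hxw, -⟩ := hC0 w hw
    obtain ⟨q, hq, hqx⟩ := hmin x hx01
    exact ⟨q, hPmem' q hq, hqx.trans hxw⟩
  · refine csSup_eq_of_forall_le_of_forall_lt_exists_gt ⟨q₀, hPmem' q₀ hq₀⟩
      (fun x hx => (hsub hx).2.le) fun w hw => ?_
    obtain ⟨x, hx01, hxw, -⟩ := hC1 w hw
    obtain ⟨q, hq, hqx⟩ := hmax x hx01
    exact ⟨q, hPmem' q hq, hxw.trans hqx⟩
  · rw [connectedComponentIn_eq (hfK x hx).1]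
    exact hPmem _ ⟨x, hx, rfl⟩

/-- If two open sets cover a preconnected set `I` and share a component there, then that
component is all of `I`. -/
theorem eq_of_connectedComponentIn_eq {X : Type*} [TopologicalSpace X] [LocallyConnectedSpace X]
    {U₁ U₂ I : Set X} {x : X} (h₁ : IsOpen U₁) (h₂ : IsOpen U₂) (hcov : U₁ ∪ U₂ = I)
    (hI : IsPreconnected I) (hx : x ∈ U₁)
    (heq : connectedComponentIn U₁ x = connectedComponentIn U₂ x) :
    connectedComponentIn U₁ x = I := by
  have key : ∀ V : Set X, IsOpen V → ∀ z ∈ V, z ∈ closure (connectedComponentIn V x) →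
      z ∈ connectedComponentIn V x := by
    intro V hV z hz hzc
    obtain ⟨y, hyz, hyx⟩ := mem_closure_iff.1 hzc _ (hV.connectedComponentIn (x := z))
      (mem_connectedComponentIn hz)
    rw [connectedComponentIn_eq hyx, ← connectedComponentIn_eq hyz]
    exact mem_connectedComponentIn hz
  refine ((connectedComponentIn_subset _ _).trans (hcov ▸ subset_union_left)).antisymm ?_
  refine hI.subset_of_closure_inter_subset h₁.connectedComponentIn
    ⟨x, hcov ▸ Or.inl hx, mem_connectedComponentIn hx⟩ ?_
  rintro z ⟨hzc, hzI⟩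
  rw [← hcov] at hzI
  rcases hzI with hz | hz
  · exact key U₁ h₁ z hz hzc
  · rw [heq] at hzc ⊢
    exact key U₂ h₂ z hz hzc

/-- From two staggered Cantor complements one can choose ℤ-ordered families of connected
components whose unions still have infimum 0, supremum 1, and are staggered. -/
theorem staggered_choose_z_families (U₁ U₂ : Set ℝ)
    (h₁ : IsCantorComplement U₁) (h₂ : IsCantorComplement U₂)
    (hstag : U₁ ∪ U₂ = Set.Ioo 0 1) :
    ∃ e₁ e₂ : ℤ → Set ℝ,
      (∀ n, ∃ x ∈ U₁, e₁ n = connectedComponentIn U₁ x) ∧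
      (∀ n, ∃ x ∈ U₂, e₂ n = connectedComponentIn U₂ x) ∧
      Function.Injective e₁ ∧ Function.Injective e₂ ∧
      (∀ m n : ℤ, m < n → ∀ x ∈ e₁ m, ∀ y ∈ e₁ n, x < y) ∧
      (∀ m n : ℤ, m < n → ∀ x ∈ e₂ m, ∀ y ∈ e₂ n, x < y) ∧
      sInf (⋃ n, e₁ n) = 0 ∧ sSup (⋃ n, e₁ n) = 1 ∧
      sInf (⋃ n, e₂ n) = 0 ∧ sSup (⋃ n, e₂ n) = 1 ∧
      (⋃ n, e₁ n) ∪ (⋃ n, e₂ n) = Set.Ioo 0 1 := by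
  have ho₁ := h₁.1
  have ho₂ := h₂.1
  have hs₁ := h₁.2.1
  have hs₂ := h₂.2.1
  have hcompl₁ : U₂ᶜ ∩ Ioo 0 1 ⊆ U₁ := by
    rintro x ⟨hx, hx01⟩
    rw [← hstag] at hx01
    exact hx01.resolve_right hx
  have hcompl₂ : U₁ᶜ ∩ Ioo 0 1 ⊆ U₂ := by
    rintro x ⟨hx, hx01⟩
    rw [← hstag] at hx01
    exact hx01.resolve_left hx
  obtain ⟨e₁, hcomp₁, hinj₁, hlt₁, hinf₁, hsup₁, hmem₁⟩ :=
    exists_int_indexed_components ho₁ hs₁ ho₂.isClosed_compl hcompl₁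
      (fun _ => h₁.exists_notMem_lt) (fun _ => h₁.exists_notMem_gt)
      (fun _ => h₂.exists_notMem_lt) (fun _ => h₂.exists_notMem_gt)
  obtain ⟨e₂, hcomp₂, hinj₂, hlt₂, hinf₂, hsup₂, hmem₂⟩ :=
    exists_int_indexed_components ho₂ hs₂ ho₁.isClosed_compl hcompl₂
      (fun _ => h₂.exists_notMem_lt) (fun _ => h₂.exists_notMem_gt)
      (fun _ => h₁.exists_notMem_lt) (fun _ => h₁.exists_notMem_gt)
  refine ⟨e₁, e₂, hcomp₁, hcomp₂, hinj₁, hinj₂, hlt₁, hlt₂, hinf₁, hsup₁, hinf₂, hsup₂, ?_⟩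
  refine (union_subset (iUnion_subset fun n => ?_) (iUnion_subset fun n => ?_)).antisymm
    fun x hx => ?_
  · obtain ⟨x, -, h⟩ := hcomp₁ n
    exact h ▸ (connectedComponentIn_subset _ _).trans hs₁
  · obtain ⟨x, -, h⟩ := hcomp₂ n
    exact h ▸ (connectedComponentIn_subset _ _).trans hs₂
  by_cases hx₂ : x ∈ U₂
  swap
  · exact Or.inl (hmem₁ x ⟨hx₂, hx⟩ (mem_connectedComponentIn (hcompl₁ ⟨hx₂, hx⟩)))
  by_cases hx₁ : x ∈ U₁
  swap
  · exact Or.inr (hmem₂ x ⟨hx₁, hx⟩ (mem_connectedComponentIn hx₂))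
  by_cases hsub₁ : connectedComponentIn U₁ x ⊆ U₂
  swap
  · obtain ⟨z, hz, hzU⟩ := not_subset.1 hsub₁
    have := hmem₁ z ⟨hzU, hs₁ (connectedComponentIn_subset _ _ hz)⟩
    rw [← connectedComponentIn_eq hz] at this
    exact Or.inl (this (mem_connectedComponentIn hx₁))
  by_cases hsub₂ : connectedComponentIn U₂ x ⊆ U₁
  swap
  · obtain ⟨z, hz, hzU⟩ := not_subset.1 hsub₂
    have := hmem₂ z ⟨hzU, hs₂ (connectedComponentIn_subset _ _ hz)⟩
    rw [← connectedComponentIn_eq hz] at this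
    exact Or.inr (this (mem_connectedComponentIn hx₂))
  have heq : connectedComponentIn U₁ x = connectedComponentIn U₂ x :=
    (isPreconnected_connectedComponentIn.subset_connectedComponentIn
      (mem_connectedComponentIn hx₁) hsub₁).antisymm
    (isPreconnected_connectedComponentIn.subset_connectedComponentIn
      (mem_connectedComponentIn hx₂) hsub₂)
  have hall := eq_of_connectedComponentIn_eq ho₁ ho₂ hstag isPreconnected_Ioo hx₁ heq
  obtain ⟨y, hy, -, hyU⟩ := h₁.exists_notMem_lt one_pos
  exact absurd (connectedComponentIn_subset U₁ x (hall ▸ hy)) hyU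
end

section
/- Let U be a Cantor complement. For every ε > 0 there exists an increasing homeomorphism f : [0,1] → [0,1] such that sup_{t ∈ [0,1]} |f(t) − t| < ε and such that U and f(U) are staggered. -/
open Set Filter Topology

/-- A strictly increasing bi-infinite sequence of reals, unbounded in both directions, extends
to an order automorphism of `ℝ`. -/
theorem exists_orderIso_forall_intCast_eq {x : ℤ → ℝ} (hx : StrictMono x)
    (hbot : ∀ y, ∃ n, x n ≤ y) (htop : ∀ y, ∃ n, y < x n) :
    ∃ P : ℝ ≃o ℝ, ∀ n : ℤ, P n = x n := by
  set p : ℝ → ℝ := fun t => x ⌊t⌋ + Int.fract t * (x (⌊t⌋ + 1) - x ⌊t⌋) with hp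
  have hgap : ∀ n, 0 < x (n + 1) - x n := fun n => sub_pos.2 (hx (lt_add_one n))
  have hlow : ∀ t, x ⌊t⌋ ≤ p t := fun t =>
    le_add_of_nonneg_right (mul_nonneg (Int.fract_nonneg t) (hgap _).le)
  have hupp : ∀ t, p t < x (⌊t⌋ + 1) := fun t => by
    have := mul_lt_mul_of_pos_right (Int.fract_lt_one t) (hgap ⌊t⌋)
    simp only [hp]
    linarith
  have hmono : StrictMono p := fun s t hst => by
    rcases (Int.floor_mono hst.le).eq_or_lt with h | h
    · have hfract : Int.fract s < Int.fract t := by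
        rw [Int.fract, Int.fract, h]
        linarith
      have := mul_lt_mul_of_pos_right hfract (hgap ⌊t⌋)
      simp only [hp, h]
      linarith
    · exact (hupp s).trans_le ((hx.monotone (Int.add_one_le_iff.2 h)).trans (hlow t))
  have hsurj : Function.Surjective p := fun y => by
    obtain ⟨m, hm⟩ := htop y
    obtain ⟨n, hn, hmax⟩ := Int.exists_greatest_of_bdd (P := fun n => x n ≤ y)
      ⟨m, fun z hz => (hx.lt_iff_lt.1 (hz.trans_lt hm)).le⟩ (hbot y)
    have hn' : y < x (n + 1) := by
      by_contra! h
      have := hmax _ h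
      omega
    have h0 : 0 ≤ (y - x n) / (x (n + 1) - x n) := div_nonneg (sub_nonneg.2 hn) (hgap n).le
    have h1 : (y - x n) / (x (n + 1) - x n) < 1 := by
      rw [div_lt_one (hgap n)]
      linarith
    refine ⟨n + (y - x n) / (x (n + 1) - x n), ?_⟩
    have hfloor : ⌊(n : ℝ) + (y - x n) / (x (n + 1) - x n)⌋ = n :=
      Int.floor_eq_iff.2 ⟨by linarith, by linarith⟩
    simp only [hp, Int.fract, hfloor, add_sub_cancel_left]
    rw [div_mul_cancel₀ _ (hgap n).ne']
    ring
  exact ⟨hmono.orderIsoOfSurjective p hsurj, fun n => by simp [hp]⟩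

/-- A dense open subset of `ℝ` and its preimage under a suitable automorphism of `ℝ`, which can be
taken arbitrarily close to the identity, cover `ℝ`. -/
theorem exists_orderIso_mem_or_apply_mem {V : Set ℝ} (hV : IsOpen V) (hd : Dense V)
    {δ : ℝ} (hδ : 0 < δ) :
    ∃ g : ℝ ≃o ℝ, (∀ t, |g t - t| ≤ 2 * δ) ∧ ∀ t, t ∈ V ∨ g t ∈ V := by
  have key : ∀ i : ℤ, ∃ l u : ℝ, i * δ < l ∧ l < u ∧ u < (i + 1) * δ ∧ Icc l u ⊆ V := fun i => by
    obtain ⟨c, hc, hcV⟩ := hd.exists_mem_open (isOpen_Ioo (a := i * δ) (b := (i + 1) * δ))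
      (nonempty_Ioo.2 (by linarith))
    obtain ⟨r, hr, hball⟩ := Metric.isOpen_iff.1 (hV.inter isOpen_Ioo) c ⟨hc, hcV⟩
    have hsub : Icc (c - r / 2) (c + r / 2) ⊆ V ∩ Ioo (i * δ) ((i + 1) * δ) := fun y hy =>
      hball (by rw [Metric.mem_ball, Real.dist_eq, abs_lt]; constructor <;> linarith [hy.1, hy.2])
    have hlt : c - r / 2 < c + r / 2 := by linarith
    exact ⟨_, _, (hsub (left_mem_Icc.2 hlt.le)).2.1, hlt, (hsub (right_mem_Icc.2 hlt.le)).2.2,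
      fun y hy => (hsub hy).1⟩
  choose l u hl hlu hu hsub using key
  set x : ℤ → ℝ := fun n => if Even n then l (n / 2) else u (n / 2) with hxdef
  have hxl : ∀ i, x (2 * i) = l i := fun i => by simp [hxdef]
  have hxu : ∀ i, x (2 * i + 1) = u i := fun i => by
    have h : (2 * i + 1) / 2 = i := by omega
    simp [hxdef, h]
  have hul : ∀ i, u i < l (i + 1) := fun i => by
    have := hl (i + 1)
    push_cast at this
    exact (hu i).trans this
  have hx : StrictMono x := strictMono_int_of_lt_succ fun n => by
    rcases Int.even_or_odd' n with ⟨i, rfl | rfl⟩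
    · rw [hxl, hxu]
      exact hlu i
    · rw [hxu, show 2 * i + 1 + 1 = 2 * (i + 1) by ring, hxl]
      exact hul i
  have hstep : ∀ n, x (n + 2) - x n ≤ 2 * δ := fun n => by
    rcases Int.even_or_odd' n with ⟨i, rfl | rfl⟩
    · rw [show 2 * i + 2 = 2 * (i + 1) by ring, hxl, hxl]
      have h1 := hu (i + 1)
      have h2 := hl i
      have h3 := hlu (i + 1)
      push_cast at h1
      linarith
    · rw [show 2 * i + 1 + 2 = 2 * (i + 1) + 1 by ring, hxu, hxu]
      have h1 := hu (i + 1)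
      have h2 := hl i
      have h3 := hlu i
      push_cast at h1
      linarith
  have hbot : ∀ y, ∃ n, x n ≤ y := fun y => by
    refine ⟨2 * (⌊y / δ⌋ - 1), ?_⟩
    rw [hxl]
    have h1 := hu (⌊y / δ⌋ - 1)
    have h2 := (le_div_iff₀ hδ).1 (Int.floor_le (y / δ))
    have h3 := hlu (⌊y / δ⌋ - 1)
    push_cast at h1
    linarith
  have htop : ∀ y, ∃ n, y < x n := fun y => by
    refine ⟨2 * (⌊y / δ⌋ + 1), ?_⟩
    rw [hxl]
    have h1 := hl (⌊y / δ⌋ + 1)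
    have h2 := (div_lt_iff₀ hδ).1 (Int.lt_floor_add_one (y / δ))
    push_cast at h1
    linarith
  obtain ⟨P, hP⟩ := exists_orderIso_forall_intCast_eq hx hbot htop
  have hcell : ∀ t, ∃ n : ℤ, (x n ≤ t ∧ t ≤ x (n + 1)) ∧
      x (n + 1) ≤ P (P.symm t + 1) ∧ P (P.symm t + 1) ≤ x (n + 2) := fun t => by
    have h1 := Int.floor_le (P.symm t)
    have h2 := (Int.lt_floor_add_one (P.symm t)).le
    refine ⟨⌊P.symm t⌋, ⟨?_, ?_⟩, ?_, ?_⟩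
    · rwa [← hP, ← P.le_symm_apply]
    · rw [← hP, ← P.symm_apply_le]
      push_cast
      exact h2
    · rw [← hP, P.le_iff_le]
      push_cast
      linarith
    · rw [← hP, P.le_iff_le]
      push_cast
      linarith
  refine ⟨(P.symm.trans (OrderIso.addRight 1)).trans P, fun t => ?_, fun t => ?_⟩
  · obtain ⟨n, ⟨h1, h2⟩, h3, h4⟩ := hcell t
    have := hstep n
    simp only [OrderIso.trans_apply, OrderIso.addRight_apply]
    rw [abs_le]
    constructor <;> linarith
  · obtain ⟨n, ⟨h1, h2⟩, h3, h4⟩ := hcell t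
    simp only [OrderIso.trans_apply, OrderIso.addRight_apply]
    rcases Int.even_or_odd' n with ⟨i, rfl | rfl⟩
    · rw [hxl] at h1
      rw [hxu] at h2
      exact Or.inl (hsub i ⟨h1, h2⟩)
    · rw [show 2 * i + 1 + 1 = 2 * (i + 1) by ring, hxl] at h3
      rw [show 2 * i + 1 + 2 = 2 * (i + 1) + 1 by ring, hxu] at h4
      exact Or.inr (hsub (i + 1) ⟨h3, h4⟩)

/-- Every order automorphism of `ℝ` is conjugate under the sigmoid function to an automorphism of
the unit interval. -/
theorem exists_orderIso_sigmoid_conj (g : ℝ ≃o ℝ) :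
    ∃ f : unitInterval ≃o unitInterval,
      ∀ s, f (unitInterval.sigmoid s) = unitInterval.sigmoid (g s) := by
  have hcases : ∀ t : unitInterval, t = 0 ∨ t = 1 ∨ ∃ s, unitInterval.sigmoid s = t := fun t => by
    rcases eq_or_ne t 0 with h | h0
    · exact Or.inl h
    rcases eq_or_ne t 1 with h | h1
    · exact Or.inr (Or.inl h)
    have : t ∈ range unitInterval.sigmoid := by
      rw [unitInterval.range_sigmoid]
      exact ⟨unitInterval.pos_iff_ne_zero.2 h0, unitInterval.lt_one_iff_ne_one.2 h1⟩
    exact Or.inr (Or.inr this)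
  set f : unitInterval → unitInterval := fun t =>
    if t = 0 then 0 else if t = 1 then 1
      else unitInterval.sigmoid (g (Function.invFun unitInterval.sigmoid t)) with hf
  have hf0 : f 0 = 0 := by simp [hf]
  have hf1 : f 1 = 1 := by simp [hf]
  have hfs : ∀ s, f (unitInterval.sigmoid s) = unitInterval.sigmoid (g s) := fun s => by
    simp only [hf, (unitInterval.sigmoid_pos s).ne', (unitInterval.sigmoid_lt_one s).ne, if_false,
      Function.leftInverse_invFun unitInterval.sigmoid_injective s]
  have hmono : StrictMono f := fun a b hab => by
    rcases hcases a with rfl | rfl | ⟨s, rfl⟩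
    · rcases hcases b with rfl | rfl | ⟨t, rfl⟩
      · exact absurd hab (lt_irrefl _)
      · rwa [hf0, hf1]
      · rw [hf0, hfs]
        exact unitInterval.sigmoid_pos _
    · exact absurd hab unitInterval.le_one'.not_gt
    · rcases hcases b with rfl | rfl | ⟨t, rfl⟩
      · exact absurd hab unitInterval.nonneg'.not_gt
      · rw [hf1, hfs]
        exact unitInterval.sigmoid_lt_one _
      · rw [hfs, hfs]
        exact unitInterval.sigmoid_lt (g.lt_iff_lt.2 (unitInterval.sigmoid_lt_iff.1 hab))
  have hsurj : Function.Surjective f := fun b => by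
    rcases hcases b with rfl | rfl | ⟨t, rfl⟩
    · exact ⟨0, hf0⟩
    · exact ⟨1, hf1⟩
    · exact ⟨unitInterval.sigmoid (g.symm t), by rw [hfs, g.apply_symm_apply]⟩
  exact ⟨hmono.orderIsoOfSurjective f hsurj, hfs⟩

theorem Real.lipschitzWith_sigmoid : LipschitzWith 1 Real.sigmoid :=
  lipschitzWith_of_nnnorm_deriv_le differentiable_sigmoid fun s => by
    have h0 := Real.sigmoid_pos s
    have h1 := Real.sigmoid_lt_one s
    rw [← NNReal.coe_le_coe, coe_nnnorm, Real.deriv_sigmoid, Real.norm_eq_abs, NNReal.coe_one,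
      abs_le]
    constructor <;> nlinarith

/-- A Cantor complement meets every nonempty open subinterval of `[0,1]`. -/
theorem IsCantorComplement.exists_mem_Ioo {U : Set ℝ} (hU : IsCantorComplement U) {a b : ℝ}
    (ha : 0 ≤ a) (hab : a < b) (hb : b ≤ 1) : ∃ c ∈ U, c ∈ Ioo a b := by
  obtain ⟨e⟩ := hU.2.2
  have : TotallyDisconnectedSpace ↥(Icc (0 : ℝ) 1 \ U) := e.symm.totallyDisconnectedSpace
  have htd : IsTotallyDisconnected (Icc (0 : ℝ) 1 \ U) :=
    totallyDisconnectedSpace_subtype_iff.1 this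
  by_contra! h
  have hsub : Ioo a b ⊆ Icc (0 : ℝ) 1 \ U := fun c hc =>
    ⟨⟨ha.trans hc.1.le, hc.2.le.trans hb⟩, fun hcU => h c hcU hc⟩
  have hss := htd _ hsub isPreconnected_Ioo
  have hm1 : (2 * a + b) / 3 ∈ Ioo a b := ⟨by linarith, by linarith⟩
  have hm2 : (a + 2 * b) / 3 ∈ Ioo a b := ⟨by linarith, by linarith⟩
  have := hss hm1 hm2
  linarith

/-- Every Cantor complement may be staggered against itself by an arbitrarily small
increasing self-homeomorphism of `[0,1]`. -/
theorem cantorComplement_stagger_perturb (U : Set ℝ) (hU : IsCantorComplement U)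
    (ε : ℝ) (hε : 0 < ε) :
    ∃ f : unitInterval ≃ₜ unitInterval, StrictMono (⇑f) ∧
      (⨆ t : unitInterval, |((f t : ℝ)) - (t : ℝ)|) < ε ∧
      U ∪ imageOnIcc f U = Set.Ioo 0 1 := by
  set V : Set ℝ := Real.sigmoid ⁻¹' U
  have hVo : IsOpen V := hU.1.preimage continuous_sigmoid
  have hVd : Dense V := dense_of_exists_between fun {a b} hab => by
    obtain ⟨c, hcU, hc⟩ := hU.exists_mem_Ioo (Real.sigmoid_nonneg a) (Real.sigmoid_lt hab)
      (Real.sigmoid_le_one b)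
    obtain ⟨s, rfl⟩ : c ∈ range Real.sigmoid := by
      rw [Real.range_sigmoid]
      exact hU.2.1 hcU
    exact ⟨s, hcU, Real.sigmoid_lt_iff.1 hc.1, Real.sigmoid_lt_iff.1 hc.2⟩
  obtain ⟨g, hgδ, hgV⟩ := exists_orderIso_mem_or_apply_mem hVo hVd (δ := ε / 4) (by positivity)
  obtain ⟨f, hf⟩ := exists_orderIso_sigmoid_conj g
  have hf0 : f 0 = 0 := f.map_bot
  have hf1 : f 1 = 1 := f.map_top
  refine ⟨f.toHomeomorph, f.strictMono, ?_, ?_⟩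
  · refine lt_of_le_of_lt (ciSup_le fun t => ?_) (half_lt_self hε)
    change |((f t : unitInterval) : ℝ) - t| ≤ ε / 2
    by_cases ht : t ∈ Ioo (0 : unitInterval) 1
    · rw [← unitInterval.range_sigmoid] at ht
      obtain ⟨s, rfl⟩ := ht
      rw [hf]
      have h := Real.lipschitzWith_sigmoid.dist_le_mul (g s) s
      rw [Real.dist_eq, Real.dist_eq, NNReal.coe_one, one_mul] at h
      have h' := hgδ s
      exact h.trans (by linarith)
    · rcases eq_or_ne t 0 with rfl | h0
      · simpa [hf0] using (half_pos hε).le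
      · rcases eq_or_ne t 1 with rfl | h1
        · simpa [hf1] using (half_pos hε).le
        · exact absurd ⟨unitInterval.pos_iff_ne_zero.2 h0,
            unitInterval.lt_one_iff_ne_one.2 h1⟩ ht
  · apply Subset.antisymm
    · rintro y (hy | ⟨_, ⟨t, ht, rfl⟩, rfl⟩)
      · exact hU.2.1 hy
      · have h0 : f 0 < f t := f.strictMono (hU.2.1 ht).1
        have h1 : f t < f 1 := f.strictMono (hU.2.1 ht).2
        rw [hf0] at h0
        rw [hf1] at h1
        exact ⟨h0, h1⟩
    · intro y hy
      rw [← Real.range_sigmoid] at hy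
      obtain ⟨s, rfl⟩ := hy
      rcases hgV (g.symm s) with h | h
      · refine Or.inr ⟨_, ⟨unitInterval.sigmoid (g.symm s), h, rfl⟩, ?_⟩
        change ((f (unitInterval.sigmoid (g.symm s)) : unitInterval) : ℝ) = _
        rw [hf, g.apply_symm_apply]
        rfl
      · rw [g.apply_symm_apply] at h
        exact Or.inl h
end
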